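/- arXiv:1707.02656 — 3 statements merged into one kernel-verified Lean document; each statement's English description precedes it below -/
import Mathlib

section
/- (Equation (4.2).) Let λ^1,…,λ^r be partitions, let B ⊆ [r] be nonempty, and let σ be any filling of λ^{[r]} with positive integer entries, with induced fillings σ^A of λ^A for A ⊆ [r]. Then inv(σ^B) = Σ_{{i,j} ⊆ B, i<j} inv(σ^{{i,j}}) − (#B−2) · Σ_{i∈B} inv(σ^{{i}}). -/
open Finset

open scoped Classical

noncomputable section

/-! ### Set partitions -/

/-- `π` is a set partition of the finite set `H`. -/
def IsSetPartition {α : Type*} (π : Finset (Finset α)) (H : Finset α) : Prop :=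
  (∀ B ∈ π, B ⊆ H) ∧ (∀ B ∈ π, B.Nonempty) ∧
    (∀ B ∈ π, ∀ C ∈ π, B ≠ C → Disjoint B C) ∧ (∀ a ∈ H, ∃ B ∈ π, a ∈ B)

/-- The finite set of all set partitions of `H`. -/
def setPartitions {α : Type*} (H : Finset α) : Finset (Finset (Finset α)) :=
  H.powerset.powerset.filter (fun π => IsSetPartition π H)

/-- The joint cumulant of the family `u` on the subset `H`. -/
def jointCumulant {A : Type*} [CommRing A] {ι : Type*} (u : Finset ι → A) (H : Finset ι) : A :=
  ∑ π ∈ setPartitions H,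
    (-1 : A) ^ (π.card - 1) * ((π.card - 1).factorial : A) * ∏ B ∈ π, u B

/-! ### Multigraphs -/

/-- Number of edges of the multigraph with endpoint map `ends` whose endpoint set is `{i,j}`. -/
def eCnt {V E : Type*} [Fintype E] (ends : E → Sym2 V) (i j : V) : ℕ :=
  (univ.filter fun e => ends e = s(i, j)).card

/-- The spanning subgraph `(V, S)` is connected. -/
def SConnected {V E : Type*} (ends : E → Sym2 V) (S : Finset E) : Prop :=
  ∀ v w : V, Relation.ReflTransGen (fun a b => ∃ e ∈ S, ends e = s(a, b)) v w

/-- The subgraph `(B, S)` is connected. -/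
def SConnectedOn {V E : Type*} (ends : E → Sym2 V) (B : Finset V) (S : Finset E) : Prop :=
  ∀ v ∈ B, ∀ w ∈ B, Relation.ReflTransGen (fun a b => ∃ e ∈ S, ends e = s(a, b)) v w

/-- `E|_B`: the edges with both endpoints in `B`. -/
def edgesIn {V E : Type*} [Fintype E] (ends : E → Sym2 V) (B : Finset V) : Finset E :=
  univ.filter fun e => ∀ v ∈ ends e, v ∈ B

/-- `c_{G|_B}(q) = Σ_{S ⊆ E|_B, (B,S) connected} q^{#S}` as a polynomial in `q`. -/
def connPoly {V E : Type*} [Fintype E] (ends : E → Sym2 V) (B : Finset V) : Polynomial ℤ :=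
  ∑ S ∈ (edgesIn ends B).powerset.filter (fun S => SConnectedOn ends B S),
    Polynomial.X ^ S.card

/-- Number of edges joining `w` to some vertex of `B`. -/
def dCnt {V E : Type*} [Fintype E] (ends : E → Sym2 V) (B : Finset V) (w : V) : ℕ :=
  (univ.filter fun e => ∃ b ∈ B, ends e = s(w, b)).card

/-! ### The `G`-inversion polynomial -/

/-- `[m]_q = 1 + q + ⋯ + q^{m-1}`. -/
def nq {R : Type*} [CommSemiring R] (q : R) (m : ℕ) : R := ∑ k ∈ Finset.range m, q ^ k

/-- Rooted spanning trees (encoded by parent maps, rooted at `0`) of the simple graph `G̃`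
underlying the multigraph on `Fin (r+1)` with edge multiplicities `e`. -/
def parentMaps {r : ℕ} (e : Fin (r+1) → Fin (r+1) → ℕ) : Finset (Fin (r+1) → Fin (r+1)) :=
  univ.filter fun p => p 0 = 0 ∧ (∀ w, w ≠ 0 → p w ≠ w ∧ 0 < e w (p w)) ∧ ∀ w, ∃ k, p^[k] w = 0

/-- `(i,j)` is a `κ`-inversion of the spanning tree encoded by `p`. -/
def isKappaInv {r : ℕ} (e : Fin (r+1) → Fin (r+1) → ℕ) (p : Fin (r+1) → Fin (r+1))
    (i j : Fin (r+1)) : Prop :=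
  i ≠ 0 ∧ j ≠ 0 ∧ i ≠ j ∧ (∃ k, p^[k] j = i) ∧ j < i ∧ p i ≠ j ∧ 0 < e j (p i)

/-- `κ(T) = Σ_{(i,j) κ-inversion} e_{parent(i), j}`. -/
def kappaStat {r : ℕ} (e : Fin (r+1) → Fin (r+1) → ℕ) (p : Fin (r+1) → Fin (r+1)) : ℕ :=
  ∑ pr ∈ (univ ×ˢ univ : Finset (Fin (r+1) × Fin (r+1))).filter
    (fun pr => isKappaInv e p pr.1 pr.2), e (p pr.1) pr.2

/-- `δ_T(w) = Σ_u e_{u, parent(w)}`, `u` ranging over descendants of `w` together with `w`. -/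
def deltaStat {r : ℕ} (e : Fin (r+1) → Fin (r+1) → ℕ) (p : Fin (r+1) → Fin (r+1))
    (w : Fin (r+1)) : ℕ :=
  ∑ u ∈ univ.filter (fun u => ∃ k, p^[k] u = w), e u (p w)

/-- The `G`-inversion polynomial `𝓘_G(q)` of the multigraph on `Fin (r+1)` with
edge multiplicities `e`, evaluated at an element `q` of a commutative (semi)ring. -/
def Iinv {r : ℕ} {R : Type*} [CommSemiring R] (e : Fin (r+1) → Fin (r+1) → ℕ) (q : R) : R :=
  q ^ (∑ i, e i i) *
    ∑ p ∈ parentMaps e, q ^ kappaStat e p * ∏ w ∈ univ.erase (0 : Fin (r+1)), nq q (e w (p w))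

/-! ### Partitions, Young diagrams and fillings -/

/-- `f : ℕ → ℕ` encodes a partition: `f j` is the `j`-th part (for `j ≥ 1`). -/
def IsPartitionFun (f : ℕ → ℕ) : Prop := Antitone f ∧ ∃ N, f N = 0

/-- The number of (nonempty) rows of the diagram of `f`. -/
def nRows (f : ℕ → ℕ) : ℕ := sSup {j | f j ≠ 0}

/-- `λ^t_i`: the length of the `i`-th column of the diagram of `f`. -/
def colLen (f : ℕ → ℕ) (i : ℕ) : ℕ :=
  ((Finset.Icc 1 (nRows f)).filter (fun j => i ≤ f j)).card

/-- The cells `(i,j)`, `1 ≤ i ≤ f j`, `j ≥ 1`, of the Young diagram of `f`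
(French convention, `i` the column index and `j` the row index). -/
def cells (f : ℕ → ℕ) : Finset (ℕ × ℕ) :=
  (Finset.Icc 1 (f 1) ×ˢ Finset.Icc 1 (nRows f)).filter (fun c => c.1 ≤ f c.2)

/-- Fillings of the diagram of `f` with entries in `{1, …, N}`, encoded as functions
`ℕ × ℕ → ℕ` vanishing outside the diagram. -/
def fillings (f : ℕ → ℕ) (N : ℕ) : Finset ((ℕ × ℕ) → ℕ) :=
  ((cells f).pi (fun _ => Finset.Icc 1 N)).image
    (fun g c => if h : c ∈ cells f then g c h else 0)

/-- The descent set of a filling. -/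
def desSet (f : ℕ → ℕ) (σ : (ℕ × ℕ) → ℕ) : Finset (ℕ × ℕ) :=
  (cells f).filter (fun c => 2 ≤ c.2 ∧ σ (c.1, c.2 - 1) < σ c)

/-- `maj(σ) = Σ_{□ ∈ Des(σ)} (leg(□) + 1)`. -/
def majStat (f : ℕ → ℕ) (σ : (ℕ × ℕ) → ℕ) : ℕ :=
  ∑ c ∈ desSet f σ, (colLen f c.1 - c.2 + 1)

/-- The counterclockwise-increasing condition defining inversion pairs; the box below `c1`
is read via `σ`, which vanishes off the diagram (giving the convention `σ(□_3) = 0`). -/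
def invTriple (σ : (ℕ × ℕ) → ℕ) (c1 c2 : ℕ × ℕ) : Prop :=
  (σ c1 ≤ σ (c1.1, c1.2 - 1) ∧ σ (c1.1, c1.2 - 1) < σ c2) ∨
  (σ (c1.1, c1.2 - 1) < σ c2 ∧ σ c2 < σ c1) ∨
  (σ c2 < σ c1 ∧ σ c1 ≤ σ (c1.1, c1.2 - 1))

/-- The set of inversion pairs of a filling. -/
def invPairs (f : ℕ → ℕ) (σ : (ℕ × ℕ) → ℕ) : Finset ((ℕ × ℕ) × (ℕ × ℕ)) :=
  ((cells f) ×ˢ (cells f)).filter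
    (fun pr => pr.1.2 = pr.2.2 ∧ pr.1.1 < pr.2.1 ∧ invTriple σ pr.1 pr.2)

/-- `inv(σ)`: the number of inversion pairs. -/
def invStat (f : ℕ → ℕ) (σ : (ℕ × ℕ) → ℕ) : ℕ := (invPairs f σ).card

/-! ### The ring `ℤ[q, t, x₁, x₂, …]` and Macdonald polynomials -/

/-- The polynomial ring `ℤ[q, t, x₀, x₁, x₂, …]`. -/
abbrev MR : Type := MvPolynomial (Fin 2 ⊕ ℕ) ℤ

/-- The variable `q`. -/
def qv : MR := MvPolynomial.X (Sum.inl 0)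

/-- The variable `t`. -/
def tv : MR := MvPolynomial.X (Sum.inl 1)

/-- The variable `x_k`. -/
def xv (k : ℕ) : MR := MvPolynomial.X (Sum.inr k)

/-- Haglund's formula: the modified Macdonald polynomial in the variables `x_1, …, x_N`. -/
def macH (f : ℕ → ℕ) (N : ℕ) : MR :=
  ∑ σ ∈ fillings f N, qv ^ invStat f σ * tv ^ majStat f σ * ∏ c ∈ cells f, xv (σ c)

/-- `λ^B = ⊕_{b ∈ B} λ^b`. -/
def lamB {r : ℕ} (lam : Fin (r+1) → ℕ → ℕ) (B : Finset (Fin (r+1))) : ℕ → ℕ :=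
  fun j => ∑ b ∈ B, lam b j

/-- The (unnormalized) Macdonald cumulant
`Σ_{π ∈ 𝒫([r])} (-1)^{#π-1} (#π-1)! Π_{B ∈ π} H̃_{λ^B}`. -/
def macCumulant {r : ℕ} (lam : Fin (r+1) → ℕ → ℕ) (N : ℕ) : MR :=
  ∑ π ∈ setPartitions (univ : Finset (Fin (r+1))),
    (-1 : MR) ^ (π.card - 1) * ((π.card - 1).factorial : MR) * ∏ B ∈ π, macH (lamB lam B) N

/-! ### Coloring of the diagram `λ^B` -/

/-- Labels `(b, i)`, `b ∈ B`, `1 ≤ i ≤ λ^b_1`, of the columns of the diagrams `λ^b`, `b ∈ B`. -/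
def columnPairs {r : ℕ} (lam : Fin (r+1) → ℕ → ℕ) (B : Finset (Fin (r+1))) :
    Finset (Fin (r+1) × ℕ) :=
  (B ×ˢ Finset.Icc 1 (lamB lam B 1)).filter (fun p => p.2 ≤ lam p.1 1)

/-- The column `p'` comes weakly before the column `p` in the sorted order
(longer first; ties first by color, then by column index). -/
def colBefore {r : ℕ} (lam : Fin (r+1) → ℕ → ℕ) (p' p : Fin (r+1) × ℕ) : Prop :=
  colLen (lam p.1) p.2 < colLen (lam p'.1) p'.2 ∨
    (colLen (lam p'.1) p'.2 = colLen (lam p.1) p.2 ∧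
      (p'.1 < p.1 ∨ (p'.1 = p.1 ∧ p'.2 ≤ p.2)))

/-- The position in `λ^B` of the column `i` of `λ^b`. -/
def posIn {r : ℕ} (lam : Fin (r+1) → ℕ → ℕ) (B : Finset (Fin (r+1)))
    (b : Fin (r+1)) (i : ℕ) : ℕ :=
  ((columnPairs lam B).filter (fun p' => colBefore lam p' (b, i))).card

/-- The label `(b, i)` of the column of `λ^B` at position `c`. -/
def colAt {r : ℕ} (lam : Fin (r+1) → ℕ → ℕ) (B : Finset (Fin (r+1))) (c : ℕ) :
    Fin (r+1) × ℕ :=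
  if h : ∃ p ∈ columnPairs lam B, posIn lam B p.1 p.2 = c then h.choose else (0, 1)

/-- The filling `σ^B` of `λ^B` induced from a filling `σ` of `λ^{[r]}` via the
identification of boxes given by the coloring. -/
def inducedFilling {r : ℕ} (lam : Fin (r+1) → ℕ → ℕ) (B : Finset (Fin (r+1)))
    (σ : (ℕ × ℕ) → ℕ) : (ℕ × ℕ) → ℕ :=
  fun cj =>
    if ∃ p ∈ columnPairs lam B, posIn lam B p.1 p.2 = cj.1 then
      σ (posIn lam univ (colAt lam B cj.1).1 (colAt lam B cj.1).2, cj.2)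
    else 0

/-- The color of the column `x` of `λ^{[r]}`. -/
def colColor {r : ℕ} (lam : Fin (r+1) → ℕ → ℕ) (x : ℕ) : Fin (r+1) :=
  (colAt lam univ x).1

/-- Edge multiplicities of the multigraph `G^σ`: the number of inversion pairs of `σ`
colored by `{i, j}`. -/
def eG {r : ℕ} (lam : Fin (r+1) → ℕ → ℕ) (σ : (ℕ × ℕ) → ℕ) (i j : Fin (r+1)) : ℕ :=
  ((invPairs (lamB lam univ) σ).filter (fun pr =>
    (colColor lam pr.1.1 = i ∧ colColor lam pr.2.1 = j) ∨
    (colColor lam pr.1.1 = j ∧ colColor lam pr.2.1 = i))).card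

/-- Edge multiplicities of the multigraph `G^{□_1,…,□_s}` attached to a set `D` of boxes:
for each box of `D` and each box strictly to its left in the same row, one edge joining
the colors of the two columns. -/
def eBox {r : ℕ} (lam : Fin (r+1) → ℕ → ℕ) (D : Finset (ℕ × ℕ)) (i j : Fin (r+1)) : ℕ :=
  ((D ×ˢ cells (lamB lam univ)).filter (fun pr =>
    pr.2.2 = pr.1.2 ∧ pr.2.1 < pr.1.1 ∧
      ((colColor lam pr.2.1 = i ∧ colColor lam pr.1.1 = j) ∨
       (colColor lam pr.2.1 = j ∧ colColor lam pr.1.1 = i)))).card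


lemma IsPartitionFun.le_nRows {f : ℕ → ℕ} (hf : IsPartitionFun f) {j : ℕ} (hj : f j ≠ 0) :
    j ≤ nRows f := by
  obtain ⟨N, hN⟩ := hf.2
  refine le_csSup ⟨N, fun k hk => ?_⟩ hj
  by_contra! h
  have := hf.1 h.le
  exact hk (by omega)

lemma IsPartitionFun.mem_cells {f : ℕ → ℕ} (hf : IsPartitionFun f) (x j : ℕ) :
    (x, j) ∈ cells f ↔ 1 ≤ x ∧ 1 ≤ j ∧ x ≤ f j := by
  simp only [cells, mem_filter, mem_product, mem_Icc]
  constructor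
  · rintro ⟨⟨⟨h1, -⟩, h2, -⟩, h3⟩
    exact ⟨h1, h2, h3⟩
  · rintro ⟨h1, h2, h3⟩
    exact ⟨⟨⟨h1, h3.trans (hf.1 h2)⟩, h2, hf.le_nRows (by omega)⟩, h3⟩

lemma IsPartitionFun.le_colLen_iff {f : ℕ → ℕ} (hf : IsPartitionFun f) {i j : ℕ}
    (hi : 1 ≤ i) (hj : 1 ≤ j) : j ≤ colLen f i ↔ i ≤ f j := by
  constructor
  · intro h
    by_contra! hlt
    have hsub : (Icc 1 (nRows f)).filter (fun k => i ≤ f k) ⊆ Icc 1 (j - 1) := by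
      intro k hk
      simp only [mem_filter, mem_Icc] at hk ⊢
      refine ⟨hk.1.1, ?_⟩
      by_contra! hjk
      have := hf.1 (show j ≤ k by omega)
      omega
    have := card_le_card hsub
    rw [Nat.card_Icc] at this
    unfold colLen at h
    omega
  · intro h
    have hsub : Icc 1 j ⊆ (Icc 1 (nRows f)).filter (fun k => i ≤ f k) := by
      intro k hk
      simp only [mem_filter, mem_Icc] at hk ⊢
      have := hf.1 hk.2
      exact ⟨⟨hk.1, hf.le_nRows (by omega)⟩, by omega⟩
    have := card_le_card hsub
    rw [Nat.card_Icc] at this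
    unfold colLen
    omega

section Columns

variable {r : ℕ} {lam : Fin (r+1) → ℕ → ℕ}

lemma isPartitionFun_lamB (hlam : ∀ b, IsPartitionFun (lam b)) (B : Finset (Fin (r+1))) :
    IsPartitionFun (lamB lam B) := by
  refine ⟨fun i j hij => sum_le_sum fun b _ => (hlam b).1 hij, ?_⟩
  choose N hN using fun b => (hlam b).2
  refine ⟨∑ b ∈ B, N b, sum_eq_zero fun b hb => ?_⟩
  have h1 : N b ≤ ∑ b ∈ B, N b := single_le_sum (f := N) (fun _ _ => Nat.zero_le _) hb
  have h2 := (hlam b).1 h1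
  have h3 := hN b
  omega

lemma mem_columnPairs {B : Finset (Fin (r+1))} {p : Fin (r+1) × ℕ} :
    p ∈ columnPairs lam B ↔ p.1 ∈ B ∧ 1 ≤ p.2 ∧ p.2 ≤ lam p.1 1 := by
  simp only [columnPairs, mem_filter, mem_product, mem_Icc]
  constructor
  · rintro ⟨⟨h1, h2, -⟩, h3⟩
    exact ⟨h1, h2, h3⟩
  · rintro ⟨h1, h2, h3⟩
    have : lam p.1 1 ≤ lamB lam B 1 :=
      single_le_sum (f := fun b => lam b 1) (fun _ _ => Nat.zero_le _) h1
    exact ⟨⟨h1, h2, h3.trans this⟩, h3⟩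

lemma colBefore_refl (p : Fin (r+1) × ℕ) : colBefore lam p p := by
  simp [colBefore]

lemma colBefore_trans {p q s : Fin (r+1) × ℕ} (h1 : colBefore lam p q)
    (h2 : colBefore lam q s) : colBefore lam p s := by
  simp only [colBefore, Fin.ext_iff, Fin.lt_def] at *
  omega

lemma colBefore_antisymm {p q : Fin (r+1) × ℕ} (h1 : colBefore lam p q)
    (h2 : colBefore lam q p) : p = q := by
  simp only [colBefore, Fin.ext_iff, Fin.lt_def, Prod.ext_iff] at *
  omega

lemma colBefore_total (p q : Fin (r+1) × ℕ) : colBefore lam p q ∨ colBefore lam q p := by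
  simp only [colBefore, Fin.ext_iff, Fin.lt_def]
  omega

lemma posIn_lt_of_not_colBefore {B : Finset (Fin (r+1))} {p q : Fin (r+1) × ℕ}
    (hq : q ∈ columnPairs lam B) (h : ¬ colBefore lam q p) :
    posIn lam B p.1 p.2 < posIn lam B q.1 q.2 := by
  have hpq : colBefore lam p q := (colBefore_total p q).resolve_right h
  refine card_lt_card ⟨fun s hs => ?_, fun hsub => h ?_⟩
  · rw [mem_filter] at hs ⊢
    exact ⟨hs.1, colBefore_trans hs.2 hpq⟩
  · exact (mem_filter.1 (hsub (mem_filter.2 ⟨hq, colBefore_refl q⟩))).2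

lemma posIn_lt_iff {B : Finset (Fin (r+1))} {p q : Fin (r+1) × ℕ}
    (hq : q ∈ columnPairs lam B) :
    posIn lam B p.1 p.2 < posIn lam B q.1 q.2 ↔ ¬ colBefore lam q p := by
  refine ⟨fun h hqp => ?_, posIn_lt_of_not_colBefore hq⟩
  refine absurd h (not_lt.2 (card_le_card fun s hs => ?_))
  rw [mem_filter] at hs ⊢
  exact ⟨hs.1, colBefore_trans hs.2 hqp⟩

lemma posIn_injOn {B : Finset (Fin (r+1))} {p q : Fin (r+1) × ℕ}
    (hp : p ∈ columnPairs lam B) (hq : q ∈ columnPairs lam B)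
    (h : posIn lam B p.1 p.2 = posIn lam B q.1 q.2) : p = q := by
  by_contra hne
  by_cases hqp : colBefore lam q p
  · have hpq : ¬ colBefore lam p q := fun hpq => hne (colBefore_antisymm hpq hqp)
    exact (posIn_lt_of_not_colBefore hp hpq).ne' h
  · exact (posIn_lt_of_not_colBefore hq hqp).ne h

lemma card_columnPairs_filter (hlam : ∀ b, IsPartitionFun (lam b)) (B : Finset (Fin (r+1)))
    {j : ℕ} (hj : 1 ≤ j) :
    ((columnPairs lam B).filter (fun p => p.2 ≤ lam p.1 j)).card = lamB lam B j := by
  have heq : (columnPairs lam B).filter (fun p => p.2 ≤ lam p.1 j) =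
      (B.sigma fun b => Icc 1 (lam b j)).map (Equiv.sigmaEquivProd _ _).toEmbedding := by
    ext ⟨b, i⟩
    have := (hlam b).1 hj
    simp only [mem_filter, mem_columnPairs, mem_map_equiv, mem_sigma, mem_Icc,
      Equiv.sigmaEquivProd_symm_apply]
    grind
  rw [heq, card_map, card_sigma]
  simp [lamB]

lemma posIn_le_lamB_iff (hlam : ∀ b, IsPartitionFun (lam b)) {B : Finset (Fin (r+1))}
    {p : Fin (r+1) × ℕ} (hp : p ∈ columnPairs lam B) {j : ℕ} (hj : 1 ≤ j) :
    posIn lam B p.1 p.2 ≤ lamB lam B j ↔ p.2 ≤ lam p.1 j := by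
  have hlen {s : Fin (r+1) × ℕ} (hs : s ∈ columnPairs lam B) :
      j ≤ colLen (lam s.1) s.2 ↔ s.2 ≤ lam s.1 j :=
    (hlam s.1).le_colLen_iff (mem_columnPairs.1 hs).2.1 hj
  rw [← card_columnPairs_filter hlam B hj]
  constructor
  · intro h
    by_contra hpj
    refine absurd h (not_le.2 (card_lt_card ⟨fun s hs => ?_, fun hsub => hpj ?_⟩))
    · rw [mem_filter] at hs ⊢
      have h1 := (hlen hs.1).2 hs.2
      have h2 := mt (hlen hp).1 hpj
      exact ⟨hs.1, Or.inl (by dsimp only; omega)⟩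
    · exact (mem_filter.1 (hsub (mem_filter.2 ⟨hp, colBefore_refl p⟩))).2
  · intro h
    refine card_le_card fun s hs => ?_
    rw [mem_filter] at hs ⊢
    refine ⟨hs.1, (hlen hs.1).1 ?_⟩
    have h1 := (hlen hp).2 h
    have h2 := hs.2
    simp only [colBefore] at h2
    omega

lemma one_le_posIn {B : Finset (Fin (r+1))} {p : Fin (r+1) × ℕ}
    (hp : p ∈ columnPairs lam B) : 1 ≤ posIn lam B p.1 p.2 :=
  card_pos.2 ⟨p, mem_filter.2 ⟨hp, colBefore_refl p⟩⟩

lemma posIn_mem_cells_iff (hlam : ∀ b, IsPartitionFun (lam b)) {B : Finset (Fin (r+1))}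
    {p : Fin (r+1) × ℕ} (hp : p ∈ columnPairs lam B) {j : ℕ} :
    (posIn lam B p.1 p.2, j) ∈ cells (lamB lam B) ↔ 1 ≤ j ∧ p.2 ≤ lam p.1 j := by
  rw [(isPartitionFun_lamB hlam B).mem_cells]
  have h1 := one_le_posIn hp
  constructor
  · rintro ⟨-, hj, h⟩
    exact ⟨hj, (posIn_le_lamB_iff hlam hp hj).1 h⟩
  · rintro ⟨hj, h⟩
    exact ⟨h1, hj, (posIn_le_lamB_iff hlam hp hj).2 h⟩

lemma exists_posIn_eq (hlam : ∀ b, IsPartitionFun (lam b)) {B : Finset (Fin (r+1))}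
    {x : ℕ} (hx : 1 ≤ x) (hx' : x ≤ lamB lam B 1) :
    ∃ p ∈ columnPairs lam B, posIn lam B p.1 p.2 = x := by
  have hcard : (Icc 1 (lamB lam B 1)).card ≤ (columnPairs lam B).card := by
    rw [Nat.card_Icc, ← card_columnPairs_filter hlam B le_rfl]
    simpa using card_filter_le _ _
  obtain ⟨p, hp, h⟩ := surj_on_of_inj_on_of_card_le
    (s := columnPairs lam B) (t := Icc 1 (lamB lam B 1)) (fun p _ => posIn lam B p.1 p.2)
    (fun p hp => mem_Icc.2 ⟨one_le_posIn hp,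
      (posIn_le_lamB_iff hlam hp le_rfl).2 (mem_columnPairs.1 hp).2.2⟩)
    (fun _ _ hp hq h => posIn_injOn hp hq h) hcard x (mem_Icc.2 ⟨hx, hx'⟩)
  exact ⟨p, hp, h.symm⟩

lemma exists_posIn_eq_of_mem_cells (hlam : ∀ b, IsPartitionFun (lam b))
    {B : Finset (Fin (r+1))} {x j : ℕ} (h : (x, j) ∈ cells (lamB lam B)) :
    ∃ p ∈ columnPairs lam B, posIn lam B p.1 p.2 = x := by
  have hB := isPartitionFun_lamB hlam B
  obtain ⟨hx, hj, hxj⟩ := (hB.mem_cells x j).1 h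
  exact exists_posIn_eq hlam hx (hxj.trans (hB.1 hj))

lemma inducedFilling_posIn {B : Finset (Fin (r+1))} {p : Fin (r+1) × ℕ}
    (hp : p ∈ columnPairs lam B) (σ : ℕ × ℕ → ℕ) (j : ℕ) :
    inducedFilling lam B σ (posIn lam B p.1 p.2, j) = σ (posIn lam univ p.1 p.2, j) := by
  have h : ∃ q ∈ columnPairs lam B, posIn lam B q.1 q.2 = posIn lam B p.1 p.2 := ⟨p, hp, rfl⟩
  have hcol : colAt lam B (posIn lam B p.1 p.2) = p := by
    rw [colAt, dif_pos h]
    exact posIn_injOn h.choose_spec.1 hp h.choose_spec.2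
  simp only [inducedFilling, if_pos h, hcol]

/-- The inversion pairs of `σ^B`, as pairs of column labels together with a row. -/
def labelInv (lam : Fin (r+1) → ℕ → ℕ) (σ : ℕ × ℕ → ℕ) (B : Finset (Fin (r+1))) :
    Finset (((Fin (r+1) × ℕ) × (Fin (r+1) × ℕ)) × ℕ) :=
  ((columnPairs lam B ×ˢ columnPairs lam B) ×ˢ Icc 1 (nRows (lamB lam B))).filter fun t =>
    t.1.1.2 ≤ lam t.1.1.1 t.2 ∧ t.1.2.2 ≤ lam t.1.2.1 t.2 ∧ ¬ colBefore lam t.1.2 t.1.1 ∧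
      invTriple σ (posIn lam univ t.1.1.1 t.1.1.2, t.2) (posIn lam univ t.1.2.1 t.1.2.2, t.2)

lemma mem_labelInv (hlam : ∀ b, IsPartitionFun (lam b)) {σ : ℕ × ℕ → ℕ}
    {B : Finset (Fin (r+1))} {p q : Fin (r+1) × ℕ} {j : ℕ} :
    ((p, q), j) ∈ labelInv lam σ B ↔
      p ∈ columnPairs lam B ∧ q ∈ columnPairs lam B ∧ 1 ≤ j ∧ p.2 ≤ lam p.1 j ∧
        q.2 ≤ lam q.1 j ∧ ¬ colBefore lam q p ∧
        invTriple σ (posIn lam univ p.1 p.2, j) (posIn lam univ q.1 q.2, j) := by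
  simp only [labelInv, mem_filter, mem_product, mem_Icc]
  constructor
  · rintro ⟨⟨⟨h1, h2⟩, h3, -⟩, h4⟩
    exact ⟨h1, h2, h3, h4⟩
  · rintro ⟨h1, h2, h3, h4⟩
    refine ⟨⟨⟨h1, h2⟩, h3, (isPartitionFun_lamB hlam B).le_nRows ?_⟩, h4⟩
    have := (posIn_le_lamB_iff hlam h1 h3).2 h4.1
    have := one_le_posIn h1
    omega

lemma invTriple_inducedFilling {B : Finset (Fin (r+1))} {p q : Fin (r+1) × ℕ}
    (hp : p ∈ columnPairs lam B) (hq : q ∈ columnPairs lam B) (σ : ℕ × ℕ → ℕ) (j : ℕ) :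
    invTriple (inducedFilling lam B σ) (posIn lam B p.1 p.2, j) (posIn lam B q.1 q.2, j) ↔
      invTriple σ (posIn lam univ p.1 p.2, j) (posIn lam univ q.1 q.2, j) := by
  simp only [invTriple, inducedFilling_posIn hp, inducedFilling_posIn hq]

lemma invStat_eq_card_labelInv (hlam : ∀ b, IsPartitionFun (lam b)) (σ : ℕ × ℕ → ℕ)
    (B : Finset (Fin (r+1))) :
    invStat (lamB lam B) (inducedFilling lam B σ) = (labelInv lam σ B).card := by
  symm
  refine card_bij (fun t _ =>
    ((posIn lam B t.1.1.1 t.1.1.2, t.2), (posIn lam B t.1.2.1 t.1.2.2, t.2))) ?_ ?_ ?_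
  · rintro ⟨⟨p, q⟩, j⟩ ht
    obtain ⟨hp, hq, hj, hpj, hqj, hpq, hinv⟩ := (mem_labelInv hlam).1 ht
    simp only [invPairs, mem_filter, mem_product]
    exact ⟨⟨(posIn_mem_cells_iff hlam hp).2 ⟨hj, hpj⟩, (posIn_mem_cells_iff hlam hq).2 ⟨hj, hqj⟩⟩,
      trivial, (posIn_lt_iff hq).2 hpq, (invTriple_inducedFilling hp hq σ j).2 hinv⟩
  · rintro ⟨⟨p, q⟩, j⟩ ht ⟨⟨p', q'⟩, j'⟩ ht' h
    obtain ⟨hp, hq, -⟩ := (mem_labelInv hlam).1 ht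
    obtain ⟨hp', hq', -⟩ := (mem_labelInv hlam).1 ht'
    simp only [Prod.mk.injEq] at h
    obtain ⟨⟨h1, h2⟩, h3, -⟩ := h
    rw [posIn_injOn hp hp' h1, posIn_injOn hq hq' h3, h2]
  · rintro ⟨⟨x, j⟩, ⟨y, j'⟩⟩ h
    simp only [invPairs, mem_filter, mem_product] at h
    obtain ⟨⟨hx, hy⟩, rfl, hxy, hinv⟩ := h
    obtain ⟨p, hp, rfl⟩ := exists_posIn_eq_of_mem_cells hlam hx
    obtain ⟨q, hq, rfl⟩ := exists_posIn_eq_of_mem_cells hlam hy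
    obtain ⟨hj, hpj⟩ := (posIn_mem_cells_iff hlam hp).1 hx
    exact ⟨((p, q), j), (mem_labelInv hlam).2 ⟨hp, hq, hj, hpj,
      ((posIn_mem_cells_iff hlam hq).1 hy).2, (posIn_lt_iff hq).1 hxy,
      (invTriple_inducedFilling hp hq σ j).1 hinv⟩, rfl⟩

/-- The number of inversion pairs whose left column has color `a` and right column color `b`. -/
def colorInv (lam : Fin (r+1) → ℕ → ℕ) (σ : ℕ × ℕ → ℕ) (a b : Fin (r+1)) : ℕ :=
  ((labelInv lam σ univ).filter fun t => (t.1.1.1, t.1.2.1) = (a, b)).card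

lemma invStat_eq_sum_colorInv (hlam : ∀ b, IsPartitionFun (lam b)) (σ : ℕ × ℕ → ℕ)
    (B : Finset (Fin (r+1))) :
    invStat (lamB lam B) (inducedFilling lam B σ) = ∑ a ∈ B, ∑ b ∈ B, colorInv lam σ a b := by
  rw [invStat_eq_card_labelInv hlam, ← sum_product',
    card_eq_sum_card_fiberwise (f := fun t => (t.1.1.1, t.1.2.1)) (t := B ×ˢ B)]
  · refine sum_congr rfl fun c hc => congrArg card ?_
    ext ⟨⟨p, q⟩, j⟩
    simp only [mem_filter, mem_labelInv hlam, mem_columnPairs, mem_univ, true_and]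
    rw [mem_product] at hc
    grind
  · rintro ⟨⟨p, q⟩, j⟩ ht
    obtain ⟨hp, hq, -⟩ := (mem_labelInv hlam).1 ht
    simp only [coe_product, Set.mem_prod, mem_coe]
    exact ⟨(mem_columnPairs.1 hp).1, (mem_columnPairs.1 hq).1⟩

end Columns

lemma sum_sum_eq_sum_lt_add_diag {ι : Type*} [LinearOrder ι] (B : Finset ι) (f : ι → ι → ℤ) :
    ∑ a ∈ B, ∑ b ∈ B, f a b =
      ∑ p ∈ (B ×ˢ B).filter (fun p => p.1 < p.2), (f p.1 p.2 + f p.2 p.1) + ∑ a ∈ B, f a a := by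
  induction B using Finset.induction_on_max with
  | empty => simp
  | insert m B hm ih =>
    have hmB : m ∉ B := fun h => lt_irrefl _ (hm m h)
    have hset : ((insert m B) ×ˢ (insert m B)).filter (fun p => p.1 < p.2) =
        (B ×ˢ B).filter (fun p => p.1 < p.2) ∪ B.image (fun b => (b, m)) := by
      ext ⟨x, y⟩
      simp only [mem_filter, mem_product, mem_insert, mem_union, mem_image,
        Prod.mk.injEq]
      constructor
      · rintro ⟨⟨rfl | hx, rfl | hy⟩, h⟩
        · exact absurd h (lt_irrefl _)
        · exact absurd h (hm y hy).not_gt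
        · exact Or.inr ⟨x, hx, rfl, rfl⟩
        · exact Or.inl ⟨⟨hx, hy⟩, h⟩
      · rintro (⟨⟨hx, hy⟩, h⟩ | ⟨b, hb, rfl, rfl⟩)
        · exact ⟨⟨Or.inr hx, Or.inr hy⟩, h⟩
        · exact ⟨⟨Or.inr hb, Or.inl rfl⟩, hm _ hb⟩
    have hdisj : Disjoint ((B ×ˢ B).filter (fun p => p.1 < p.2))
        (B.image (fun b => (b, m))) := by
      rw [disjoint_left]
      rintro ⟨x, y⟩ h1 h2
      simp only [mem_filter, mem_product, mem_image, Prod.mk.injEq] at h1 h2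
      obtain ⟨b, -, -, rfl⟩ := h2
      exact hmB h1.1.2
    rw [hset, sum_union hdisj, sum_image fun x _ y _ h => congrArg Prod.fst h]
    simp only [sum_insert hmB, sum_add_distrib] at ih ⊢
    linarith

lemma sum_lt_add_eq_card_sub_one_mul {ι : Type*} [LinearOrder ι] (B : Finset ι) (g : ι → ℤ) :
    ∑ p ∈ (B ×ˢ B).filter (fun p => p.1 < p.2), (g p.1 + g p.2) =
      ((B.card : ℤ) - 1) * ∑ a ∈ B, g a := by
  have h := sum_sum_eq_sum_lt_add_diag B (fun a _ => g a)
  simp only [sum_const, nsmul_eq_mul, ← mul_sum] at h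
  linarith

/-- **Equation (4.2).** For any nonempty `B ⊆ [r]` and any filling `σ` of `λ^{[r]}`
with positive integer entries,
`inv(σ^B) = Σ_{{i,j}⊆B, i<j} inv(σ^{{i,j}}) - (#B-2) Σ_{i∈B} inv(σ^{{i}})`. -/
theorem stmt10 {r : ℕ} (lam : Fin (r+1) → ℕ → ℕ) (hlam : ∀ b, IsPartitionFun (lam b))
    (B : Finset (Fin (r+1))) (hB : B.Nonempty)
    (σ : (ℕ × ℕ) → ℕ)
    (hσ1 : ∀ c ∈ cells (lamB lam univ), 1 ≤ σ c)
    (hσ0 : ∀ c, c ∉ cells (lamB lam univ) → σ c = 0) :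
    (invStat (lamB lam B) (inducedFilling lam B σ) : ℤ) =
      (∑ pr ∈ (B ×ˢ B).filter (fun pr => pr.1 < pr.2),
        (invStat (lamB lam {pr.1, pr.2}) (inducedFilling lam {pr.1, pr.2} σ) : ℤ)) -
      ((B.card : ℤ) - 2) * ∑ i ∈ B, (invStat (lamB lam {i}) (inducedFilling lam {i} σ) : ℤ) := by
  have hsingle (i : Fin (r+1)) :
      (invStat (lamB lam {i}) (inducedFilling lam {i} σ) : ℤ) = colorInv lam σ i i := by
    rw [invStat_eq_sum_colorInv hlam, sum_singleton, sum_singleton]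
  have hpair : ∀ p ∈ (B ×ˢ B).filter (fun p => p.1 < p.2),
      (invStat (lamB lam {p.1, p.2}) (inducedFilling lam {p.1, p.2} σ) : ℤ) =
        ((colorInv lam σ p.1 p.2 : ℤ) + colorInv lam σ p.2 p.1) +
          ((colorInv lam σ p.1 p.1 : ℤ) + colorInv lam σ p.2 p.2) := by
    intro p hp
    have hne : p.1 ≠ p.2 := (mem_filter.1 hp).2.ne
    rw [invStat_eq_sum_colorInv hlam]
    simp only [sum_pair hne]
    push_cast
    ring
  rw [sum_congr rfl hpair, sum_add_distrib,
    sum_lt_add_eq_card_sub_one_mul B (fun i => (colorInv lam σ i i : ℤ)),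
    sum_congr rfl fun i _ => hsingle i, invStat_eq_sum_colorInv hlam]
  push_cast
  rw [sum_sum_eq_sum_lt_add_diag B (fun a b => (colorInv lam σ a b : ℤ))]
  ring

end
end

section
/- Let λ^1,…,λ^r be partitions and let {□_1,…,□_s} be a set of s distinct boxes of λ^{[r]}. If □' is any box of λ^{[r]} lying in the same column as □_k (for some k ∈ [s]) and □' ∉ {□_1,…,□_s}, then the multigraphs G^{□_1,…,□_k,…,□_s} and G^{□_1,…,□',…,□_s} (the latter obtained by replacing □_k with □') coincide, i.e. they have the same number of edges with endpoint set {i,j} for every pair i,j ∈ [r]. In particular G^{□_1,…,□_s} depends only on the columns containing the boxes □_1,…,□_s. -/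
open Finset

open scoped Classical

noncomputable section

/-- The boxes of `D` contribute to `eBox` through their column indices only. -/
theorem eBox_eq_sum {r : ℕ} (lam : Fin (r+1) → ℕ → ℕ) {D : Finset (ℕ × ℕ)}
    (hD : D ⊆ cells (lamB lam univ)) (i j : Fin (r+1)) :
    eBox lam D i j = ∑ c ∈ D, ((Finset.Ico 1 c.1).filter (fun x =>
      (colColor lam x = i ∧ colColor lam c.1 = j) ∨
      (colColor lam x = j ∧ colColor lam c.1 = i))).card := by
  rw [eBox, Finset.card_filter, Finset.sum_product]
  refine Finset.sum_congr rfl fun c hc => ?_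
  have hcell := hD hc
  rw [← Finset.card_filter]
  simp only [cells, Finset.mem_filter, Finset.mem_product, Finset.mem_Icc] at hcell
  refine Finset.card_bij' (fun p _ => p.1) (fun x _ => (x, c.2)) ?_ ?_ ?_ ?_
  · intro p hp
    simp only [cells, Finset.mem_filter, Finset.mem_product, Finset.mem_Icc] at hp
    simp only [Finset.mem_filter, Finset.mem_Ico]
    exact ⟨⟨hp.1.1.1.1, hp.2.2.1⟩, hp.2.2.2⟩
  · intro x hx
    simp only [Finset.mem_filter, Finset.mem_Ico] at hx
    simp only [cells, Finset.mem_filter, Finset.mem_product, Finset.mem_Icc]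
    exact ⟨⟨⟨⟨hx.1.1, by omega⟩, hcell.1.2⟩, by omega⟩, trivial, hx.1.2, hx.2⟩
  · intro p hp
    exact Prod.ext rfl (Finset.mem_filter.mp hp).2.1.symm
  · intro x _
    rfl

/-- Replacing a box `□_k` of the set `{□_1,…,□_s}` by another box `□'` of the same column
does not change the multigraph `G^{□_1,…,□_s}`: both have the same number of edges with
endpoint set `{i,j}` for every pair `i, j ∈ [r]`. -/
theorem stmt12 {r : ℕ} (lam : Fin (r+1) → ℕ → ℕ) (hlam : ∀ b, IsPartitionFun (lam b))
    (D : Finset (ℕ × ℕ)) (hD : D ⊆ cells (lamB lam univ))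
    (bk : ℕ × ℕ) (hbk : bk ∈ D)
    (b' : ℕ × ℕ) (hb' : b' ∈ cells (lamB lam univ)) (hcol : b'.1 = bk.1) (hnot : b' ∉ D) :
    ∀ i j : Fin (r+1), eBox lam (insert b' (D.erase bk)) i j = eBox lam D i j := by
  intro i j
  have hD' : insert b' (D.erase bk) ⊆ cells (lamB lam univ) :=
    Finset.insert_subset hb' ((Finset.erase_subset _ _).trans hD)
  rw [eBox_eq_sum lam hD', eBox_eq_sum lam hD,
    Finset.sum_insert fun h => hnot (Finset.mem_of_mem_erase h), hcol]
  exact Finset.add_sum_erase D (fun c => ((Finset.Ico 1 c.1).filter (fun x =>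
    (colColor lam x = i ∧ colColor lam c.1 = j) ∨
    (colColor lam x = j ∧ colColor lam c.1 = i))).card) hbk

end
end

section
/- (Proposition 6.4, monomial positivity of fully colored Macdonald polynomials at q = −1.) Let a_1,…,a_r be positive integers, let λ^i = (1^{a_i}) be single-column partitions, and let N ≥ 1. Let P ∈ ℤ[q,t,x_1,…,x_N] be the (necessarily unique) polynomial with (q−1)^{r−1} · P = Σ_{π ∈ 𝒫([r])} (−1)^{#π−1}(#π−1)! Π_{B∈π} H̃_{λ^B}^{(N)}. Then the polynomial in t, x_1,…,x_N obtained by substituting q = −1 into P has nonnegative integer coefficients. -/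
open Finset

open scoped Classical

noncomputable section

/-- The substitution `q ↦ -1` (keeping `t` and the `x` variables). -/
def substQneg1 : (Fin 2 ⊕ ℕ) → MR :=
  Sum.elim (fun i : Fin 2 => if i = 0 then (-1 : MR) else tv) (fun k => xv k)

/-! ### Subset convolution and cumulants -/

theorem mem_setPartitions {α : Type*} {H : Finset α} {π : Finset (Finset α)} :
    π ∈ setPartitions H ↔ IsSetPartition π H := by
  simp only [setPartitions, mem_filter, mem_powerset, and_iff_right_iff_imp]
  intro h B hB
  exact mem_powerset.2 (h.1 B hB)

theorem IsSetPartition.erase {α : Type*} {H B : Finset α} {π : Finset (Finset α)}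
    (h : IsSetPartition π H) (hB : B ∈ π) : IsSetPartition (π.erase B) (H \ B) := by
  obtain ⟨h1, h2, h3, h4⟩ := h
  refine ⟨fun C hC => ?_, fun C hC => h2 C (mem_of_mem_erase hC),
    fun C hC D hD => h3 C (mem_of_mem_erase hC) D (mem_of_mem_erase hD), fun x hx => ?_⟩
  · rw [mem_erase] at hC
    exact subset_sdiff.2 ⟨h1 C hC.2, h3 C hC.2 B hB hC.1⟩
  · rw [mem_sdiff] at hx
    obtain ⟨C, hC, hxC⟩ := h4 x hx.1
    refine ⟨C, mem_erase.2 ⟨?_, hC⟩, hxC⟩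
    rintro rfl
    exact hx.2 hxC

theorem IsSetPartition.insert_block {α : Type*} {H B : Finset α} {π : Finset (Finset α)}
    (hBH : B ⊆ H) (hB : B.Nonempty) (h : IsSetPartition π (H \ B)) :
    IsSetPartition (insert B π) H := by
  obtain ⟨h1, h2, h3, h4⟩ := h
  refine ⟨fun C hC => ?_, fun C hC => ?_, fun C hC D hD hCD => ?_, fun x hx => ?_⟩
  · rcases mem_insert.1 hC with rfl | hC
    · exact hBH
    · exact (h1 C hC).trans sdiff_subset
  · rcases mem_insert.1 hC with rfl | hC
    · exact hB
    · exact h2 C hC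
  · rcases mem_insert.1 hC with hC | hC <;> rcases mem_insert.1 hD with hD | hD
    · exact absurd (hC.trans hD.symm) hCD
    · exact hC ▸ (subset_sdiff.1 (h1 D hD)).2.symm
    · exact hD ▸ (subset_sdiff.1 (h1 C hC)).2
    · exact h3 C hC D hD hCD
  · by_cases hxB : x ∈ B
    · exact ⟨B, mem_insert_self _ _, hxB⟩
    · obtain ⟨C, hC, hxC⟩ := h4 x (mem_sdiff.2 ⟨hx, hxB⟩)
      exact ⟨C, mem_insert_of_mem hC, hxC⟩

theorem IsSetPartition.notMem_block {α : Type*} {H B : Finset α} {π : Finset (Finset α)}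
    (hB : B.Nonempty) (h : IsSetPartition π (H \ B)) : B ∉ π := by
  intro hBπ
  obtain ⟨x, hx⟩ := hB
  exact (mem_sdiff.1 (h.1 B hBπ hx)).2 hx

/-- Choosing a set partition with a distinguished block amounts to choosing the block and a
set partition of its complement. -/
theorem sum_setPartitions_blocks {α M : Type*} [AddCommMonoid M] (H : Finset α)
    (f : Finset α → Finset (Finset α) → M) :
    ∑ π ∈ setPartitions H, ∑ B ∈ π, f B (π.erase B) =
      ∑ B ∈ H.powerset with B.Nonempty, ∑ π ∈ setPartitions (H \ B), f B π := by
  rw [Finset.sum_sigma', Finset.sum_sigma']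
  refine Finset.sum_bij' (fun x _ => ⟨x.2, x.1.erase x.2⟩) (fun x _ => ⟨insert x.1 x.2, x.1⟩)
    ?_ ?_ ?_ ?_ ?_
  · rintro ⟨π, B⟩ h
    simp only [mem_sigma, mem_setPartitions] at h
    simp only [mem_sigma, mem_setPartitions, mem_filter, mem_powerset]
    exact ⟨⟨h.1.1 B h.2, h.1.2.1 B h.2⟩, h.1.erase h.2⟩
  · rintro ⟨B, π⟩ h
    simp only [mem_sigma, mem_setPartitions, mem_filter, mem_powerset] at h
    simp only [mem_sigma, mem_setPartitions, mem_insert_self, and_true]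
    exact IsSetPartition.insert_block h.1.1 h.1.2 h.2
  · rintro ⟨π, B⟩ h
    simp only [mem_sigma] at h
    simp [insert_erase h.2]
  · rintro ⟨B, π⟩ h
    simp only [mem_sigma, mem_setPartitions, mem_filter, mem_powerset] at h
    simp [erase_insert (IsSetPartition.notMem_block h.1.2 h.2)]
  · intros
    rfl

/-- Subset convolution. -/
def subsetConv {ι A : Type*} [CommRing A] (f g : Finset ι → A) (H : Finset ι) : A :=
  ∑ S ∈ H.powerset, f S * g (H \ S)

section SubsetConv

variable {ι A : Type*} [CommRing A]

theorem subsetConv_congr {f f' g g' : Finset ι → A} {H : Finset ι}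
    (hf : ∀ S ⊆ H, f S = f' S) (hg : ∀ S ⊆ H, g S = g' S) :
    subsetConv f g H = subsetConv f' g' H := by
  refine Finset.sum_congr rfl fun S hS => ?_
  rw [hf S (mem_powerset.1 hS), hg _ sdiff_subset]

theorem subsetConv_comm (f g : Finset ι → A) : subsetConv f g = subsetConv g f := by
  funext H
  refine Finset.sum_nbij' (fun S => H \ S) (fun S => H \ S) ?_ ?_ ?_ ?_ ?_
  · intro S _; simp
  · intro S _; simp
  · intro S hS; simpa using mem_powerset.1 hS
  · intro S hS; simpa using mem_powerset.1 hS
  · intro S hS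
    rw [Finset.sdiff_sdiff_eq_self (mem_powerset.1 hS), mul_comm]

theorem subsetConv_assoc (f g h : Finset ι → A) :
    subsetConv (subsetConv f g) h = subsetConv f (subsetConv g h) := by
  funext H
  simp only [subsetConv, Finset.sum_mul, Finset.mul_sum]
  rw [Finset.sum_sigma', Finset.sum_sigma']
  refine Finset.sum_bij' (fun x _ => ⟨x.2, x.1 \ x.2⟩) (fun x _ => ⟨x.1 ∪ x.2, x.1⟩) ?_ ?_ ?_ ?_ ?_
  · rintro ⟨S, T⟩ h
    simp only [mem_sigma, mem_powerset] at h ⊢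
    exact ⟨h.2.trans h.1, sdiff_subset_sdiff h.1 le_rfl⟩
  · rintro ⟨S, T⟩ h
    simp only [mem_sigma, mem_powerset] at h ⊢
    exact ⟨union_subset h.1 (h.2.trans sdiff_subset), subset_union_left⟩
  · rintro ⟨S, T⟩ h
    simp only [mem_sigma, mem_powerset] at h ⊢
    simp [h.2]
  · rintro ⟨S, T⟩ h
    simp only [mem_sigma, mem_powerset] at h ⊢
    have : (S ∪ T) \ S = T := by
      rw [union_sdiff_left]
      exact sdiff_eq_self_of_disjoint (subset_sdiff.1 h.2).2
    simp [this]
  · rintro ⟨S, T⟩ h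
    simp only [mem_sigma, mem_powerset] at h ⊢
    have : (H \ T) \ (S \ T) = H \ S := by
      ext x
      have := @h.2 x
      simp only [mem_sdiff]
      tauto
    rw [this, mul_assoc]

theorem subsetConv_insert (f g : Finset ι → A) {i : ι} {H : Finset ι} (hi : i ∉ H) :
    subsetConv f g (insert i H) =
      subsetConv (fun S => f (insert i S)) g H + subsetConv f (fun S => g (insert i S)) H := by
  rw [subsetConv, Finset.sum_powerset_insert hi, add_comm]
  congr 1
  · refine Finset.sum_congr rfl fun S hS => ?_
    congr 2
    ext x
    simp only [mem_sdiff, mem_insert]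
    constructor
    · tauto
    · rintro ⟨h1, h2⟩
      refine ⟨Or.inr h1, ?_⟩
      rintro (rfl | h)
      · exact hi h1
      · exact h2 h
  · refine Finset.sum_congr rfl fun S hS => ?_
    rw [insert_sdiff_of_notMem _ (fun h => hi (mem_powerset.1 hS h))]

/-- The unit of subset convolution. -/
def subsetOne (H : Finset ι) : A := if H = ∅ then 1 else 0

theorem subsetConv_one (f : Finset ι → A) : subsetConv f subsetOne = f := by
  funext H
  rw [subsetConv, Finset.sum_eq_single H]
  · simp [subsetOne]
  · intro S hS hne
    have : H \ S ≠ ∅ := fun h => hne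
      (Subset.antisymm (mem_powerset.1 hS) (sdiff_eq_empty_iff_subset.1 h))
    simp [subsetOne, this]
  · intro h
    exact absurd (mem_powerset_self H) h

theorem subsetConv_mul_prod (s : ι → A) (f g : Finset ι → A) (H : Finset ι) :
    subsetConv (fun S => (∏ i ∈ S, s i) * f S) (fun S => (∏ i ∈ S, s i) * g S) H =
      (∏ i ∈ H, s i) * subsetConv f g H := by
  simp only [subsetConv, Finset.mul_sum]
  refine Finset.sum_congr rfl fun S hS => ?_
  rw [← Finset.prod_sdiff (mem_powerset.1 hS)]
  ring

/-- The inverse of `u` with respect to subset convolution. -/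
def subsetInv (u : Finset ι → A) (H : Finset ι) : A :=
  ∑ π ∈ setPartitions H, (-1 : A) ^ π.card * (π.card.factorial : A) * ∏ B ∈ π, u B

theorem setPartitions_empty : setPartitions (∅ : Finset ι) = {∅} := by
  ext π
  rw [mem_setPartitions, mem_singleton]
  constructor
  · intro h
    by_contra hne
    obtain ⟨B, hB⟩ := nonempty_iff_ne_empty.2 hne
    obtain ⟨x, hx⟩ := h.2.1 B hB
    simpa using h.1 B hB hx
  · rintro rfl
    simp [IsSetPartition]

theorem subsetConv_inv (u : Finset ι → A) (hu : u ∅ = 1) :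
    subsetConv u (subsetInv u) = subsetOne := by
  funext H
  rcases H.eq_empty_or_nonempty with rfl | hH
  · simp [subsetConv, subsetInv, subsetOne, setPartitions_empty, hu]
  have key : subsetInv u H =
      - ∑ B ∈ H.powerset with B.Nonempty, u B * subsetInv u (H \ B) := by
    have := sum_setPartitions_blocks H
      (fun B π => u B * ((-1 : A) ^ π.card * (π.card.factorial : A) * ∏ C ∈ π, u C))
    simp only [subsetInv, Finset.mul_sum]
    rw [← this, ← Finset.sum_neg_distrib]
    refine Finset.sum_congr rfl fun π hπ => ?_
    rw [mem_setPartitions] at hπ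
    have hne : 0 < π.card := by
      obtain ⟨x, hx⟩ := hH
      obtain ⟨B, hB, -⟩ := hπ.2.2.2 x hx
      exact card_pos.2 ⟨B, hB⟩
    obtain ⟨k, hk⟩ : ∃ k, π.card = k + 1 := ⟨π.card - 1, by omega⟩
    have : ∀ B ∈ π, u B * ((-1 : A) ^ (π.erase B).card * ((π.erase B).card.factorial : A) *
        ∏ C ∈ π.erase B, u C) = (-1) ^ k * (k.factorial : A) * ∏ C ∈ π, u C := by
      intro B hB
      rw [card_erase_of_mem hB, hk, ← Finset.mul_prod_erase π u hB, Nat.add_sub_cancel]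
      ring
    rw [Finset.sum_congr rfl this, Finset.sum_const, hk, Nat.factorial_succ]
    simp
    ring
  have h2 : subsetConv u (subsetInv u) H = subsetInv u H +
      ∑ B ∈ H.powerset with B.Nonempty, u B * subsetInv u (H \ B) := by
    rw [subsetConv, ← Finset.sum_filter_add_sum_filter_not _ (fun B : Finset ι => B.Nonempty),
      add_comm]
    congr 1
    rw [Finset.sum_eq_single ∅]
    · simp [hu]
    · intro B hB hne
      simp [not_nonempty_iff_eq_empty] at hB
      exact absurd hB.2 hne
    · simp
  rw [h2, key]
  simp [subsetOne, hH.ne_empty]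

/-- A cumulant is a rooted logarithmic derivative. -/
theorem jointCumulant_insert (u : Finset ι → A) {i : ι} {H : Finset ι} (hi : i ∉ H) :
    jointCumulant u (insert i H) = subsetConv (fun S => u (insert i S)) (subsetInv u) H := by
  have h1 := sum_setPartitions_blocks (insert i H) (fun B π => if i ∈ B then
      u B * ((-1 : A) ^ π.card * (π.card.factorial : A) * ∏ C ∈ π, u C) else 0)
  have h2 : jointCumulant u (insert i H) = ∑ π ∈ setPartitions (insert i H), ∑ B ∈ π,
      if i ∈ B then u B * ((-1 : A) ^ (π.erase B).card * ((π.erase B).card.factorial : A) *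
        ∏ C ∈ π.erase B, u C) else 0 := by
    refine Finset.sum_congr rfl fun π hπ => ?_
    rw [mem_setPartitions] at hπ
    obtain ⟨B, hB, hiB⟩ := hπ.2.2.2 i (mem_insert_self _ _)
    rw [Finset.sum_eq_single_of_mem B hB, if_pos hiB, card_erase_of_mem hB,
      ← Finset.mul_prod_erase π u hB]
    · ring
    · intro C hC hne
      rw [if_neg]
      intro hiC
      exact disjoint_left.1 (hπ.2.2.1 C hC B hB hne) hiC hiB
  rw [h2, h1, Finset.sum_filter, Finset.sum_powerset_insert hi, Finset.sum_eq_zero, zero_add]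
  · refine Finset.sum_congr rfl fun S hS => ?_
    have : insert i H \ insert i S = H \ S := by
      ext x
      simp only [mem_sdiff, mem_insert]
      constructor
      · tauto
      · rintro ⟨hx, h2⟩
        refine ⟨Or.inr hx, ?_⟩
        rintro (rfl | h)
        · exact hi hx
        · exact h2 h
    simp only [insert_nonempty, if_true, mem_insert_self, this, subsetInv, Finset.mul_sum]
  · intro S hS
    have : i ∉ S := fun h => hi (mem_powerset.1 hS h)
    simp [this]

/-- Recursion for cumulants obtained by deleting the vertex `o`. -/
theorem jointCumulant_insert_insert (u : Finset ι → A) (hu : u ∅ = 1) (s : ι → A) {o i : ι}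
    {H : Finset ι} (hoi : o ≠ i) (ho : o ∉ H) (hi : i ∉ H)
    (hs : ∀ S ⊆ insert i H, u (insert o S) = (∏ j ∈ S, s j) * u S) :
    jointCumulant u (insert o (insert i H)) =
      ∑ S ∈ H.powerset, ((∏ j ∈ insert i S, s j) - 1) *
        (jointCumulant u (insert i S) * jointCumulant u (insert o (H \ S))) := by
  set v := subsetInv u with hv
  set K : Finset ι → A := fun S => jointCumulant u (insert i S) with hK
  set K₀ : Finset ι → A := fun S => jointCumulant u (insert o S) with hK₀
  set σu : Finset ι → A := fun S => (∏ j ∈ S, s j) * u S with hσu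
  have huv : subsetConv u v = subsetOne := subsetConv_inv u hu
  have hvu : subsetConv v u = subsetOne := by rw [subsetConv_comm, huv]
  have hone : ∀ f : Finset ι → A, subsetConv subsetOne f = f := fun f => by
    rw [subsetConv_comm, subsetConv_one]
  have hK_eq : ∀ S ⊆ H, K S = subsetConv (fun T => u (insert i T)) v S := fun S hS =>
    jointCumulant_insert u (fun h => hi (hS h))
  have hK₀_eq : ∀ S ⊆ insert i H, K₀ S = subsetConv σu v S := fun S hS => by
    rw [hK₀]
    simp only
    rw [jointCumulant_insert u (i := o) (H := S)]
    · exact subsetConv_congr (fun T hT => hs T (hT.trans hS)) (fun _ _ => rfl)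
    · intro h
      rcases mem_insert.1 (hS h) with h | h
      · exact hoi h
      · exact ho h
  have hHi : H ⊆ insert i H := subset_insert _ _
  have hDu : ∀ S ⊆ H, u (insert i S) = subsetConv K u S := fun S hS => by
    have : subsetConv K u S = subsetConv (subsetConv (fun T => u (insert i T)) v) u S :=
      subsetConv_congr (fun T hT => hK_eq T (hT.trans hS)) (fun _ _ => rfl)
    rw [this, subsetConv_assoc, hvu, subsetConv_one]
  have hDv : ∀ S ⊆ H, v (insert i S) = - subsetConv v (subsetConv (fun T => u (insert i T)) v) S := by
    intro S hS
    have h0 : ∀ T ⊆ S, subsetConv u (fun T => v (insert i T)) T =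
        - subsetConv (fun T => u (insert i T)) v T := fun T hT => by
      have := subsetConv_insert u v (fun h => hi (hS (hT h)) : i ∉ T)
      rw [huv] at this
      simp only [subsetOne, insert_ne_empty, if_false] at this
      linear_combination -this
    calc v (insert i S) = subsetConv v (subsetConv u (fun T => v (insert i T))) S := by
          rw [← subsetConv_assoc, hvu, hone]
      _ = subsetConv v (fun T => - subsetConv (fun T => u (insert i T)) v T) S :=
          subsetConv_congr (fun _ _ => rfl) h0
      _ = _ := by simp [subsetConv]
  have hfirst : subsetConv (fun S => σu (insert i S)) v H =
      s i * subsetConv (fun S => (∏ j ∈ S, s j) * K S) K₀ H := by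
    have h1 : subsetConv (fun S => σu (insert i S)) v H = subsetConv (fun S =>
        s i * subsetConv (fun S => (∏ j ∈ S, s j) * K S) σu S) v H := by
      refine subsetConv_congr (fun S hS => ?_) (fun _ _ => rfl)
      rw [subsetConv_mul_prod, ← hDu S hS, hσu]
      simp only
      rw [Finset.prod_insert (fun h => hi (hS h)), mul_assoc]
    have h2 : subsetConv (fun S =>
        s i * subsetConv (fun S => (∏ j ∈ S, s j) * K S) σu S) v H = s i *
        subsetConv (subsetConv (fun S => (∏ j ∈ S, s j) * K S) σu) v H := by
      rw [subsetConv, subsetConv, Finset.mul_sum]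
      simp only [mul_assoc]
    rw [h1, h2, subsetConv_assoc]
    congr 1
    exact subsetConv_congr (fun _ _ => rfl) (fun S hS => (hK₀_eq S (hS.trans hHi)).symm)
  have hsecond : subsetConv σu (fun S => v (insert i S)) H = - subsetConv K K₀ H := by
    calc _ = subsetConv σu (fun S => - subsetConv v (subsetConv (fun T => u (insert i T)) v) S) H :=
          subsetConv_congr (fun _ _ => rfl) hDv
      _ = - subsetConv (subsetConv σu v) (subsetConv (fun T => u (insert i T)) v) H := by
          rw [subsetConv_assoc]
          simp [subsetConv]
      _ = - subsetConv K₀ K H := by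
          rw [subsetConv_congr (fun S hS => (hK₀_eq S (hS.trans hHi)).symm)
            (fun S hS => (hK_eq S hS).symm)]
      _ = _ := by rw [subsetConv_comm]
  change K₀ (insert i H) = _
  rw [hK₀_eq _ subset_rfl, subsetConv_insert _ _ hi, hfirst, hsecond, subsetConv, subsetConv,
    Finset.mul_sum, ← sub_eq_add_neg, ← Finset.sum_sub_distrib]
  refine Finset.sum_congr rfl fun S hS => ?_
  rw [Finset.prod_insert (fun h => hi (mem_powerset.1 hS h))]
  ring

end SubsetConv

/-- The cumulant of a product of pairwise signs is a natural multiple of a power of `-2`. -/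
theorem jointCumulant_sign {ι : Type*} (s : ι → ι → ℤ) (hs : ∀ i j, s i j = 1 ∨ s i j = -1)
    (hd : ∀ i, s i i = 1) (n : ℕ) :
    ∀ (o : ι) (H : Finset ι), o ∉ H → H.card = n → ∃ k : ℕ,
      jointCumulant (fun B => ∏ b ∈ B, ∏ c ∈ B, s b c) (insert o H) = (-2) ^ n * (k : ℤ) := by
  induction n using Nat.strong_induction_on with
  | _ n ih =>
    intro o H ho hn
    set u : Finset ι → ℤ := fun B => ∏ b ∈ B, ∏ c ∈ B, s b c with hu
    have hu0 : u ∅ = 1 := by simp [hu]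
    have hins : ∀ S, o ∉ S → u (insert o S) = (∏ j ∈ S, s o j * s j o) * u S := by
      intro S hS
      simp only [hu, Finset.prod_insert hS, hd, Finset.prod_mul_distrib]
      ring
    rcases H.eq_empty_or_nonempty with rfl | ⟨i, hiH⟩
    · refine ⟨1, ?_⟩
      have h1 : u {o} = 1 := by simp [hu, hd]
      rw [jointCumulant_insert u ho]
      simp [subsetConv, subsetInv, setPartitions_empty, h1, ← hn]
    · obtain ⟨H', hi, rfl⟩ : ∃ H', i ∉ H' ∧ insert i H' = H :=
        ⟨H.erase i, notMem_erase _ _, insert_erase hiH⟩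
      rw [card_insert_of_notMem hi] at hn
      have hoi : o ≠ i := fun h => ho (h ▸ mem_insert_self _ _)
      have ho' : o ∉ H' := fun h => ho (mem_insert_of_mem h)
      rw [jointCumulant_insert_insert u hu0 (fun j => s o j * s j o) hoi ho' hi
        (fun S hS => hins S (fun h => ho (hS h)))]
      have hterm : ∀ S ∈ H'.powerset, ∃ k : ℕ, ((∏ j ∈ insert i S, (s o j * s j o)) - 1) *
          (jointCumulant u (insert i S) * jointCumulant u (insert o (H' \ S))) =
            (-2) ^ n * (k : ℤ) := by
        intro S hS
        have hS := mem_powerset.1 hS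
        have hcard := card_sdiff_add_card_eq_card hS
        obtain ⟨k₁, hk₁⟩ := ih S.card (by omega) i S (fun h => hi (hS h)) rfl
        obtain ⟨k₂, hk₂⟩ := ih (H' \ S).card (by omega) o (H' \ S)
          (fun h => ho' (sdiff_subset h)) rfl
        have hsign : (∏ j ∈ insert i S, (s o j * s j o)) = 1 ∨
            (∏ j ∈ insert i S, (s o j * s j o)) = -1 := by
          refine Finset.prod_induction _ (fun x : ℤ => x = 1 ∨ x = -1) ?_ (Or.inl rfl) ?_
          · rintro a b (rfl | rfl) (rfl | rfl) <;> simp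
          · intro j _
            rcases hs o j with h | h <;> rcases hs j o with h' | h' <;> simp [h, h']
        rw [hk₁, hk₂, ← hn, ← hcard]
        rcases hsign with h | h
        · exact ⟨0, by rw [h]; simp⟩
        · refine ⟨k₁ * k₂, ?_⟩
          rw [h]
          push_cast
          ring
      choose! k hk using hterm
      refine ⟨∑ S ∈ H'.powerset, k S, ?_⟩
      rw [Finset.sum_congr rfl hk, ← Finset.mul_sum]
      push_cast
      rfl

/-! ### Fillings of arbitrary sets of boxes -/

/-- Functions with values in `{1, …, N}` on `S`, extended by zero. -/
def fillingsOn {α : Type*} [DecidableEq α] (S : Finset α) (N : ℕ) : Finset (α → ℕ) :=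
  (S.pi (fun _ => Finset.Icc 1 N)).image (fun g c => if h : c ∈ S then g c h else 0)

section FillingsOn

variable {α β R : Type*} [DecidableEq α] [CommRing R] {N : ℕ}

theorem mem_fillingsOn {S : Finset α} {σ : α → ℕ} :
    σ ∈ fillingsOn S N ↔ (∀ c ∈ S, 1 ≤ σ c ∧ σ c ≤ N) ∧ ∀ c ∉ S, σ c = 0 := by
  simp only [fillingsOn, mem_image, mem_pi, mem_Icc]
  constructor
  · rintro ⟨g, hg, rfl⟩
    refine ⟨fun c hc => ?_, fun c hc => ?_⟩
    · simpa [hc] using hg c hc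
    · simp [hc]
  · rintro ⟨h1, h2⟩
    refine ⟨fun c _ => σ c, h1, ?_⟩
    funext c
    by_cases hc : c ∈ S
    · simp [hc]
    · simp [hc, h2 c hc]

theorem sum_fillingsOn_union {S T : Finset α} (hST : Disjoint S T) (f g : (α → ℕ) → R)
    (hf : ∀ σ τ : α → ℕ, (∀ c ∈ S, σ c = τ c) → f σ = f τ)
    (hg : ∀ σ τ : α → ℕ, (∀ c ∈ T, σ c = τ c) → g σ = g τ) :
    (∑ σ ∈ fillingsOn S N, f σ) * (∑ τ ∈ fillingsOn T N, g τ) =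
      ∑ σ ∈ fillingsOn (S ∪ T) N, f σ * g σ := by
  rw [Finset.sum_mul_sum, ← Finset.sum_product']
  have hT : ∀ c ∈ S, c ∉ T := fun c hc => disjoint_left.1 hST hc
  have hS : ∀ c ∈ T, c ∉ S := fun c hc => disjoint_right.1 hST hc
  refine Finset.sum_bij' (fun x _ => x.1 + x.2)
    (fun σ _ => (fun c => if c ∈ S then σ c else 0, fun c => if c ∈ T then σ c else 0))
    ?_ ?_ ?_ ?_ ?_
  · rintro ⟨σ, τ⟩ h
    simp only [mem_product, mem_fillingsOn] at h
    obtain ⟨⟨h1, h2⟩, h3, h4⟩ := h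
    rw [mem_fillingsOn]
    refine ⟨fun c hc => ?_, fun c hc => ?_⟩
    · rcases mem_union.1 hc with hc | hc
      · simpa [h4 c (hT c hc)] using h1 c hc
      · simpa [h2 c (hS c hc)] using h3 c hc
    · rw [mem_union, not_or] at hc
      simp [h2 c hc.1, h4 c hc.2]
  · intro σ h
    rw [mem_fillingsOn] at h
    simp only [mem_product, mem_fillingsOn]
    refine ⟨⟨fun c hc => ?_, fun c hc => ?_⟩, fun c hc => ?_, fun c hc => ?_⟩
    · simpa [hc] using h.1 c (mem_union_left _ hc)
    · simp [hc]
    · simpa [hc] using h.1 c (mem_union_right _ hc)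
    · simp [hc]
  · rintro ⟨σ, τ⟩ h
    simp only [mem_product, mem_fillingsOn] at h
    obtain ⟨⟨h1, h2⟩, h3, h4⟩ := h
    refine Prod.ext (funext fun c => ?_) (funext fun c => ?_)
    · by_cases hc : c ∈ S
      · simp [hc, h4 c (hT c hc)]
      · simp [hc, h2 c hc]
    · by_cases hc : c ∈ T
      · simp [hc, h2 c (hS c hc)]
      · simp [hc, h4 c hc]
  · intro σ h
    rw [mem_fillingsOn] at h
    funext c
    by_cases hc : c ∈ S
    · simp [hc, hT c hc]
    · by_cases hc' : c ∈ T
      · simp [hc, hc']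
      · simp [hc, hc', h.2 c (by simp [hc, hc'])]
  · rintro ⟨σ, τ⟩ h
    simp only [mem_product, mem_fillingsOn] at h
    obtain ⟨⟨h1, h2⟩, h3, h4⟩ := h
    congr 1
    · exact hf _ _ fun c hc => by simp [h4 c (hT c hc)]
    · exact hg _ _ fun c hc => by simp [h2 c (hS c hc)]

theorem prod_sum_fillingsOn (π : Finset β) (S : β → Finset α)
    (hS : ∀ B ∈ π, ∀ C ∈ π, B ≠ C → Disjoint (S B) (S C)) (f : β → (α → ℕ) → R)
    (hf : ∀ B ∈ π, ∀ σ τ : α → ℕ, (∀ c ∈ S B, σ c = τ c) → f B σ = f B τ) :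
    ∏ B ∈ π, ∑ σ ∈ fillingsOn (S B) N, f B σ =
      ∑ σ ∈ fillingsOn (π.biUnion S) N, ∏ B ∈ π, f B σ := by
  induction π using Finset.induction_on with
  | empty => simp [fillingsOn]
  | insert B π hB ih =>
    rw [Finset.prod_insert hB, ih
      (fun C hC D hD => hS C (mem_insert_of_mem hC) D (mem_insert_of_mem hD))
      (fun C hC => hf C (mem_insert_of_mem hC)), biUnion_insert, sum_fillingsOn_union]
    · simp only [Finset.prod_insert hB]
    · rw [disjoint_biUnion_right]
      intro C hC
      exact hS B (mem_insert_self _ _) C (mem_insert_of_mem hC) (fun h => hB (h ▸ hC))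
    · exact hf B (mem_insert_self _ _)
    · intro σ τ h
      refine Finset.prod_congr rfl fun C hC => ?_
      exact hf C (mem_insert_of_mem hC) σ τ fun c hc => h c (mem_biUnion.2 ⟨C, hC, hc⟩)

theorem sum_fillingsOn_bijOn [DecidableEq β] {S : Finset α} {C : Finset β} {φ : α → β}
    (hφ : Set.BijOn φ S C) (f : (β → ℕ) → R) (g : (α → ℕ) → R)
    (hfg : ∀ σ ∈ fillingsOn C N, f σ = g (fun p => if p ∈ S then σ (φ p) else 0)) :
    ∑ σ ∈ fillingsOn C N, f σ = ∑ τ ∈ fillingsOn S N, g τ := by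
  obtain ⟨ψ, hψ⟩ : ∃ ψ : β → Option α, ∀ c ∈ C, ∃ p ∈ S, ψ c = some p ∧ φ p = c := by
    have : ∀ c, ∃ o : Option α, c ∈ C → ∃ p ∈ S, o = some p ∧ φ p = c := by
      intro c
      by_cases hc : c ∈ C
      · obtain ⟨p, hp, hpc⟩ := hφ.surjOn hc
        exact ⟨some p, fun _ => ⟨p, hp, rfl, hpc⟩⟩
      · exact ⟨none, fun h => absurd h hc⟩
    choose ψ hψ using this
    exact ⟨ψ, hψ⟩
  have hψφ : ∀ p ∈ S, ψ (φ p) = some p := by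
    intro p hp
    obtain ⟨p', hp', h1, h2⟩ := hψ (φ p) (hφ.mapsTo hp)
    rw [h1, hφ.injOn hp' hp h2]
  refine Finset.sum_bij' (fun σ _ => fun p => if p ∈ S then σ (φ p) else 0)
    (fun τ _ => fun c => if c ∈ C then (ψ c).elim 0 τ else 0) ?_ ?_ ?_ ?_ hfg
  · intro σ hσ
    rw [mem_fillingsOn] at hσ ⊢
    refine ⟨fun p hp => ?_, fun p hp => by simp [hp]⟩
    simpa [hp] using hσ.1 (φ p) (hφ.mapsTo hp)
  · intro τ hτ
    rw [mem_fillingsOn] at hτ ⊢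
    refine ⟨fun c hc => ?_, fun c hc => by simp [hc]⟩
    obtain ⟨p, hp, h1, -⟩ := hψ c hc
    simpa [hc, h1] using hτ.1 p hp
  · intro σ hσ
    rw [mem_fillingsOn] at hσ
    funext c
    by_cases hc : c ∈ C
    · obtain ⟨p, hp, h1, h2⟩ := hψ c hc
      simp [hc, h1, hp, h2]
    · simp [hc, hσ.2 c hc]
  · intro τ hτ
    rw [mem_fillingsOn] at hτ
    funext p
    by_cases hp : p ∈ S
    · have : φ p ∈ C := hφ.mapsTo hp
      simp [hp, this, hψφ p hp]
    · simp [hp, hτ.2 p hp]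

end FillingsOn

/-! ### Diagrams assembled from single columns -/

section Columns

variable {r : ℕ} (a : Fin (r+1) → ℕ) (ρ : Fin (r+1) → ℕ) (B : Finset (Fin (r+1)))

/-- The family of single-column partitions `(1^{a_b})`. -/
def columnFamily (b : Fin (r+1)) (j : ℕ) : ℕ := if 1 ≤ j ∧ j ≤ a b then 1 else 0

/-- The boxes `(b, j)`, `b ∈ B`, `1 ≤ j ≤ a_b`. -/
def columnBoxes : Finset (Fin (r+1) × ℕ) :=
  B.biUnion fun b => (Finset.Icc 1 (a b)).image (Prod.mk b)

/-- The rank of `b` in `B` with respect to `ρ`. -/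
def columnRank (b : Fin (r+1)) : ℕ := (B.filter fun c => ρ c ≤ ρ b).card

variable {a B} in
theorem mem_columnBoxes {p : Fin (r+1) × ℕ} :
    p ∈ columnBoxes a B ↔ p.1 ∈ B ∧ 1 ≤ p.2 ∧ p.2 ≤ a p.1 := by
  obtain ⟨b, j⟩ := p
  simp only [columnBoxes, mem_biUnion, mem_image, mem_Icc, Prod.mk.injEq]
  constructor
  · rintro ⟨c, hc, k, hk, rfl, rfl⟩
    exact ⟨hc, hk⟩
  · rintro ⟨h1, h2⟩
    exact ⟨b, h1, j, h2, rfl, rfl⟩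

theorem lamB_columnFamily {j : ℕ} (hj : 1 ≤ j) :
    lamB (columnFamily a) B j = (B.filter fun b => j ≤ a b).card := by
  simp only [lamB, columnFamily, hj, true_and, Finset.card_filter]

theorem lamB_columnFamily_pos {b : Fin (r+1)} (hb : b ∈ B) {j : ℕ} (hj : 1 ≤ j) (hjb : j ≤ a b) :
    1 ≤ lamB (columnFamily a) B j := by
  rw [lamB_columnFamily a B hj]
  exact card_pos.2 ⟨b, mem_filter.2 ⟨hb, hjb⟩⟩

theorem le_nRows_columnFamily {j : ℕ} (h : 1 ≤ lamB (columnFamily a) B j) :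
    j ≤ nRows (lamB (columnFamily a) B) := by
  refine le_csSup ⟨∑ b, a b, ?_⟩ (show lamB (columnFamily a) B j ≠ 0 by omega)
  intro k hk
  by_contra hlt
  refine hk ?_
  rw [lamB]
  refine Finset.sum_eq_zero fun b _ => ?_
  have : a b ≤ ∑ b, a b := Finset.single_le_sum (fun _ _ => Nat.zero_le _) (mem_univ b)
  rw [columnFamily, if_neg]
  omega

theorem mem_cells_columnFamily {c : ℕ × ℕ} :
    c ∈ cells (lamB (columnFamily a) B) ↔
      1 ≤ c.1 ∧ 1 ≤ c.2 ∧ c.1 ≤ lamB (columnFamily a) B c.2 := by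
  simp only [cells, mem_filter, mem_product, mem_Icc]
  constructor
  · tauto
  · rintro ⟨h1, h2, h3⟩
    refine ⟨⟨⟨h1, h3.trans ?_⟩, h2, le_nRows_columnFamily a B (h1.trans h3)⟩, h3⟩
    rw [lamB_columnFamily a B h2, lamB_columnFamily a B le_rfl]
    exact card_le_card fun b hb => by
      simp only [mem_filter] at hb ⊢
      exact ⟨hb.1, h2.trans hb.2⟩

theorem columnRank_pos {b : Fin (r+1)} (hb : b ∈ B) : 1 ≤ columnRank ρ B b :=
  card_pos.2 ⟨b, mem_filter.2 ⟨hb, le_rfl⟩⟩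

theorem columnRank_lt_iff {b c : Fin (r+1)} (hc : c ∈ B) :
    columnRank ρ B b < columnRank ρ B c ↔ ρ b < ρ c := by
  constructor
  · intro h
    by_contra hle
    refine absurd h (not_lt.2 (card_le_card fun d hd => ?_))
    simp only [mem_filter] at hd ⊢
    exact ⟨hd.1, by omega⟩
  · intro h
    refine card_lt_card ⟨fun d hd => ?_, fun hsub => ?_⟩
    · simp only [mem_filter] at hd ⊢
      exact ⟨hd.1, by omega⟩
    · have := hsub (mem_filter.2 ⟨hc, le_rfl⟩)
      simp only [mem_filter] at this
      omega

variable {ρ} in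
theorem columnRank_injOn (hinj : Function.Injective ρ) : Set.InjOn (columnRank ρ B) B := by
  intro b hb c hc h
  have h1 := columnRank_lt_iff ρ B (b := b) hc
  have h2 := columnRank_lt_iff ρ B (b := c) hb
  exact hinj (by omega)

variable {ρ} in
theorem exists_columnRank_eq (hinj : Function.Injective ρ) {i : ℕ} (h1 : 1 ≤ i)
    (h2 : i ≤ B.card) : ∃ b ∈ B, columnRank ρ B b = i := by
  have hsub : B.image (columnRank ρ B) ⊆ Finset.Icc 1 B.card := by
    intro k hk
    obtain ⟨b, hb, rfl⟩ := mem_image.1 hk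
    exact mem_Icc.2 ⟨columnRank_pos ρ B hb, card_filter_le _ _⟩
  have heq := eq_of_subset_of_card_le hsub
    (by rw [card_image_of_injOn (columnRank_injOn B hinj)]; simp)
  have : i ∈ B.image (columnRank ρ B) := by
    rw [heq]
    exact mem_Icc.2 ⟨h1, h2⟩
  exact mem_image.1 this

variable {a ρ} in
theorem columnRank_le_iff (hρ : ∀ b c, ρ b ≤ ρ c → a c ≤ a b)
    {b : Fin (r+1)} (hb : b ∈ B) {j : ℕ} (hj : 1 ≤ j) :
    columnRank ρ B b ≤ lamB (columnFamily a) B j ↔ j ≤ a b := by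
  rw [lamB_columnFamily a B hj]
  constructor
  · intro h
    by_contra hlt
    refine absurd h (not_le.2 (card_lt_card ⟨fun c hc => ?_, fun hsub => ?_⟩))
    · simp only [mem_filter] at hc ⊢
      refine ⟨hc.1, ?_⟩
      by_contra hcb
      have := hρ b c (by omega)
      omega
    · have := hsub (mem_filter.2 ⟨hb, le_rfl⟩)
      simp only [mem_filter] at this
      omega
  · intro h
    refine card_le_card fun c hc => ?_
    simp only [mem_filter] at hc ⊢
    exact ⟨hc.1, h.trans (hρ c b hc.2)⟩

variable {a ρ} in
theorem mem_cells_columnRank (hρ : ∀ b c, ρ b ≤ ρ c → a c ≤ a b)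
    {b : Fin (r+1)} (hb : b ∈ B) (j : ℕ) :
    (columnRank ρ B b, j) ∈ cells (lamB (columnFamily a) B) ↔ (b, j) ∈ columnBoxes a B := by
  rw [mem_cells_columnFamily, mem_columnBoxes]
  have h1 := columnRank_pos ρ B hb
  constructor
  · rintro ⟨-, h2, h3⟩
    exact ⟨hb, h2, (columnRank_le_iff B hρ hb h2).1 h3⟩
  · rintro ⟨-, h2, h3⟩
    exact ⟨h1, h2, (columnRank_le_iff B hρ hb h2).2 h3⟩

variable {a ρ} in
theorem bijOn_columnBoxes_cells (hinj : Function.Injective ρ)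
    (hρ : ∀ b c, ρ b ≤ ρ c → a c ≤ a b) :
    Set.BijOn (fun p : Fin (r+1) × ℕ => (columnRank ρ B p.1, p.2)) (columnBoxes a B)
      (cells (lamB (columnFamily a) B)) := by
  refine ⟨?_, ?_, ?_⟩
  · rintro ⟨b, j⟩ hp
    exact (mem_cells_columnRank B hρ (mem_columnBoxes.1 hp).1 j).2 hp
  · rintro ⟨b, j⟩ hp ⟨c, k⟩ hq h
    simp only [Prod.mk.injEq] at h ⊢
    exact ⟨columnRank_injOn B hinj (mem_columnBoxes.1 hp).1 (mem_columnBoxes.1 hq).1 h.1, h.2⟩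
  · rintro ⟨i, j⟩ hc
    have hc' := hc
    rw [mem_coe, mem_cells_columnFamily] at hc'
    obtain ⟨h1, h2, h3⟩ := hc'
    simp only at h1 h2 h3
    rw [lamB_columnFamily a B h2] at h3
    obtain ⟨b, hb, rfl⟩ := exists_columnRank_eq B hinj h1 (h3.trans (card_filter_le _ _))
    exact ⟨(b, j), (mem_cells_columnRank B hρ hb j).1 hc, rfl⟩

variable {a ρ} in
theorem colLen_columnRank (hρ : ∀ b c, ρ b ≤ ρ c → a c ≤ a b) {b : Fin (r+1)} (hb : b ∈ B) :
    colLen (lamB (columnFamily a) B) (columnRank ρ B b) = a b := by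
  have : (Finset.Icc 1 (nRows (lamB (columnFamily a) B))).filter
      (fun j => columnRank ρ B b ≤ lamB (columnFamily a) B j) = Finset.Icc 1 (a b) := by
    ext j
    simp only [mem_filter, mem_Icc]
    constructor
    · rintro ⟨⟨h1, -⟩, h2⟩
      exact ⟨h1, (columnRank_le_iff B hρ hb h1).1 h2⟩
    · rintro ⟨h1, h2⟩
      exact ⟨⟨h1, le_nRows_columnFamily a B (lamB_columnFamily_pos a B hb h1 h2)⟩,
        (columnRank_le_iff B hρ hb h1).2 h2⟩
  rw [colLen, this]
  simp

/-- The triple condition for entries `x` and `z` in a row, with `y` below `x`. -/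
def isInvTriple (x y z : ℕ) : Prop :=
  (x ≤ y ∧ y < z) ∨ (y < z ∧ z < x) ∨ (z < x ∧ x ≤ y)

/-- The entry below the box `(b, j)`, with the convention that it is `0` for `j = 1`. -/
def entryBelow (τ : Fin (r+1) × ℕ → ℕ) (b : Fin (r+1)) (j : ℕ) : ℕ :=
  if j = 1 then 0 else τ (b, j - 1)

/-- The number of inversion pairs between the columns `b` and `c`. -/
def columnInv (τ : Fin (r+1) × ℕ → ℕ) (b c : Fin (r+1)) : ℕ :=
  ((Finset.Icc 1 (min (a b) (a c))).filter fun j =>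
    ρ b < ρ c ∧ isInvTriple (τ (b, j)) (entryBelow τ b j) (τ (c, j))).card

/-- The contribution of a box to the major index. -/
def columnMaj (τ : Fin (r+1) × ℕ → ℕ) (p : Fin (r+1) × ℕ) : ℕ :=
  if 2 ≤ p.2 ∧ τ (p.1, p.2 - 1) < τ p then a p.1 - p.2 + 1 else 0

variable {a ρ} in
/-- Haglund's formula for a union of columns, as a sum over fillings of the separate columns. -/
theorem macH_columnFamily (hinj : Function.Injective ρ)
    (hρ : ∀ b c, ρ b ≤ ρ c → a c ≤ a b) (N : ℕ) :
    macH (lamB (columnFamily a) B) N = ∑ τ ∈ fillingsOn (columnBoxes a B) N,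
      qv ^ (∑ b ∈ B, ∑ c ∈ B, columnInv a ρ τ b c) *
        ∏ p ∈ columnBoxes a B, tv ^ columnMaj a τ p * xv (τ p) := by
  have hbij := bijOn_columnBoxes_cells B hinj hρ
  have hfill : fillings (lamB (columnFamily a) B) N =
      fillingsOn (cells (lamB (columnFamily a) B)) N := rfl
  rw [macH, hfill]
  refine sum_fillingsOn_bijOn hbij _ _ fun σ hσ => ?_
  rw [mem_fillingsOn] at hσ
  set τ : Fin (r+1) × ℕ → ℕ :=
    fun p => if p ∈ columnBoxes a B then σ (columnRank ρ B p.1, p.2) else 0 with hτ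
  have hστ : ∀ b ∈ B, ∀ j, σ (columnRank ρ B b, j) = τ (b, j) := by
    intro b hb j
    by_cases h : (b, j) ∈ columnBoxes a B
    · simp [hτ, h]
    · simp only [hτ, h, if_false]
      exact hσ.2 _ fun h' => h ((mem_cells_columnRank B hρ hb j).1 h')
  have hbelow : ∀ b ∈ B, ∀ j, 1 ≤ j → τ (b, j - 1) = entryBelow τ b j := by
    intro b hb j hj
    rw [entryBelow]
    split_ifs with h
    · simp [hτ, mem_columnBoxes, h]
    · rfl
  have hinv : invStat (lamB (columnFamily a) B) σ = ∑ b ∈ B, ∑ c ∈ B, columnInv a ρ τ b c := by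
    rw [← Finset.sum_product']
    simp only [columnInv]
    rw [← card_sigma]
    symm
    refine Finset.card_bij
      (fun x _ => ((columnRank ρ B x.1.1, x.2), (columnRank ρ B x.1.2, x.2))) ?_ ?_ ?_
    · rintro ⟨⟨b, c⟩, j⟩ h
      simp only [mem_sigma, mem_product, mem_filter, mem_Icc, le_min_iff] at h
      obtain ⟨⟨hb, hc⟩, ⟨h1, h2, h3⟩, h4, h5⟩ := h
      simp only [invPairs, mem_filter, mem_product, mem_cells_columnRank B hρ hb,
        mem_cells_columnRank B hρ hc, mem_columnBoxes, columnRank_lt_iff ρ B hc]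
      refine ⟨⟨⟨hb, h1, h2⟩, hc, h1, h3⟩, trivial, h4, ?_⟩
      simp only [invTriple, hστ b hb, hστ c hc, hbelow b hb j h1]
      exact h5
    · rintro ⟨⟨b, c⟩, j⟩ h ⟨⟨b', c'⟩, j'⟩ h' heq
      simp only [mem_sigma, mem_product] at h h'
      simp only [Prod.mk.injEq] at heq
      obtain ⟨⟨h1, rfl⟩, h2, -⟩ := heq
      obtain rfl := columnRank_injOn B hinj h.1.1 h'.1.1 h1
      obtain rfl := columnRank_injOn B hinj h.1.2 h'.1.2 h2
      rfl
    · rintro ⟨c1, c2⟩ h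
      simp only [invPairs, mem_filter, mem_product] at h
      obtain ⟨⟨h1, h2⟩, h3, h4, h5⟩ := h
      obtain ⟨⟨b, j⟩, hb, rfl⟩ := hbij.surjOn h1
      obtain ⟨⟨c, k⟩, hc, rfl⟩ := hbij.surjOn h2
      simp only at h3
      subst h3
      rw [mem_coe, mem_columnBoxes] at hb hc
      simp only [invTriple, hστ b hb.1, hστ c hc.1, hbelow b hb.1 j hb.2.1] at h5
      refine ⟨⟨(b, c), j⟩, ?_, rfl⟩
      simp only [mem_sigma, mem_product, mem_filter, mem_Icc, le_min_iff]
      exact ⟨⟨hb.1, hc.1⟩, ⟨hb.2.1, hb.2.2, hc.2.2⟩, (columnRank_lt_iff ρ B hc.1).1 h4, h5⟩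
  have hmaj : majStat (lamB (columnFamily a) B) σ =
      ∑ p ∈ columnBoxes a B, columnMaj a τ p := by
    rw [majStat, desSet, Finset.sum_filter]
    symm
    refine Finset.sum_nbij _ hbij.mapsTo hbij.injOn hbij.surjOn ?_
    rintro ⟨b, j⟩ hp
    have hb := (mem_columnBoxes.1 hp).1
    simp only [columnMaj, hστ b hb, colLen_columnRank B hρ hb]
  have hx : ∏ c ∈ cells (lamB (columnFamily a) B), xv (σ c) =
      ∏ p ∈ columnBoxes a B, xv (τ p) := by
    symm
    refine Finset.prod_nbij _ hbij.mapsTo hbij.injOn hbij.surjOn ?_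
    rintro ⟨b, j⟩ hp
    rw [hστ b (mem_columnBoxes.1 hp).1]
  rw [hinv, hmaj, hx, Finset.prod_mul_distrib, Finset.prod_pow_eq_pow_sum, mul_assoc]

end Columns

theorem columnInv_congr {r : ℕ} (a : Fin (r+1) → ℕ) (ρ : Fin (r+1) → ℕ) {B : Finset (Fin (r+1))}
    {σ τ : Fin (r+1) × ℕ → ℕ} (h : ∀ p ∈ columnBoxes a B, σ p = τ p) {b c : Fin (r+1)}
    (hb : b ∈ B) (hc : c ∈ B) : columnInv a ρ σ b c = columnInv a ρ τ b c := by
  rw [columnInv, columnInv]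
  congr 1
  refine Finset.filter_congr fun j hj => ?_
  rw [mem_Icc, le_min_iff] at hj
  have h1 : σ (b, j) = τ (b, j) := h _ (mem_columnBoxes.2 ⟨hb, hj.1, hj.2.1⟩)
  have h2 : σ (c, j) = τ (c, j) := h _ (mem_columnBoxes.2 ⟨hc, hj.1, hj.2.2⟩)
  have h3 : entryBelow σ b j = entryBelow τ b j := by
    rw [entryBelow, entryBelow]
    split_ifs with hj1
    · rfl
    · exact h _ (mem_columnBoxes.2 ⟨hb, by simp only; omega, by simp only; omega⟩)
  rw [h1, h2, h3]

theorem columnMaj_congr {r : ℕ} (a : Fin (r+1) → ℕ) {B : Finset (Fin (r+1))}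
    {σ τ : Fin (r+1) × ℕ → ℕ} (h : ∀ p ∈ columnBoxes a B, σ p = τ p) {p : Fin (r+1) × ℕ}
    (hp : p ∈ columnBoxes a B) : columnMaj a σ p = columnMaj a τ p := by
  rw [columnMaj, columnMaj, h p hp]
  by_cases h2 : 2 ≤ p.2
  · have hp' := mem_columnBoxes.1 hp
    rw [h (p.1, p.2 - 1) (mem_columnBoxes.2 ⟨hp'.1, by simp only; omega, by simp only; omega⟩)]
  · simp [h2]

theorem exists_rank_antitone {r : ℕ} (a : Fin (r+1) → ℕ) :
    ∃ ρ : Fin (r+1) → ℕ, Function.Injective ρ ∧ ∀ b c, ρ b ≤ ρ c → a c ≤ a b := by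
  refine ⟨fun b => ((Tuple.sort (fun b => OrderDual.toDual (a b))).symm b : ℕ), ?_, ?_⟩
  · exact Fin.val_injective.comp (Equiv.injective _)
  · intro b c h
    have := Tuple.monotone_sort (fun b => OrderDual.toDual (a b)) (Fin.le_def.2 h)
    simpa using this

theorem coeff_nonneg_of_mem_rangeS {τ : Type*} {p : MvPolynomial τ ℤ}
    (hp : p ∈ (MvPolynomial.map (σ := τ) (Nat.castRingHom ℤ)).rangeS) (m : τ →₀ ℕ) :
    0 ≤ MvPolynomial.coeff m p := by
  obtain ⟨p, rfl⟩ := hp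
  rw [MvPolynomial.coeff_map]
  exact Int.natCast_nonneg _

theorem prod_signs_pow {ι R : Type*} [CommRing R] (B : Finset ι) (e : ι → ι → ℕ) :
    (-1 : R) ^ (∑ b ∈ B, ∑ c ∈ B, e b c) =
      ((∏ b ∈ B, ∏ c ∈ B, (-1 : ℤ) ^ e b c : ℤ) : R) := by
  simp [Finset.prod_pow_eq_pow_sum]

/-- **Proposition 6.4.** For single-column partitions `λ^b = (1^{a_b})`, the fully colored
Macdonald polynomial (the normalized cumulant `P`) evaluated at `q = -1` has nonnegative
integer coefficients. -/
theorem stmt13 (r N : ℕ) (hN : 1 ≤ N) (a : Fin (r+1) → ℕ) (ha : ∀ b, 1 ≤ a b)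
    (P : MR)
    (hP : (qv - 1) ^ r * P =
      macCumulant (fun b j => if 1 ≤ j ∧ j ≤ a b then 1 else 0) N) :
    ∀ m : (Fin 2 ⊕ ℕ) →₀ ℕ, 0 ≤ MvPolynomial.coeff m (MvPolynomial.aeval substQneg1 P) := by
  obtain ⟨ρ, hinj, hρ⟩ := exists_rank_antitone a
  set w : (Fin (r+1) × ℕ → ℕ) → Fin (r+1) × ℕ → MR :=
    fun τ p => tv ^ columnMaj a τ p * xv (τ p) with hw
  set s : (Fin (r+1) × ℕ → ℕ) → Fin (r+1) → Fin (r+1) → ℤ :=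
    fun τ b c => (-1) ^ columnInv a ρ τ b c with hs
  have hq : MvPolynomial.aeval substQneg1 qv = (-1 : MR) := by simp [qv, substQneg1]
  have ht : MvPolynomial.aeval substQneg1 tv = tv := by
    rw [tv, MvPolynomial.aeval_X]
    simp [substQneg1, tv]
  have hx : ∀ k, MvPolynomial.aeval substQneg1 (xv k) = xv k := by
    intro k
    rw [xv, MvPolynomial.aeval_X]
    simp [substQneg1, xv]
  have hmac : ∀ B : Finset (Fin (r+1)),
      MvPolynomial.aeval substQneg1 (macH (lamB (columnFamily a) B) N) =
        ∑ τ ∈ fillingsOn (columnBoxes a B) N,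
          ((∏ b ∈ B, ∏ c ∈ B, s τ b c : ℤ) : MR) * ∏ p ∈ columnBoxes a B, w τ p := by
    intro B
    rw [macH_columnFamily B hinj hρ]
    simp only [map_sum, map_mul, map_pow, map_prod, hq, ht, hx, prod_signs_pow, hs, hw]
  have hprod : ∀ π ∈ setPartitions (univ : Finset (Fin (r+1))),
      ∏ B ∈ π, MvPolynomial.aeval substQneg1 (macH (lamB (columnFamily a) B) N) =
        ∑ τ ∈ fillingsOn (columnBoxes a univ) N, (∏ p ∈ columnBoxes a univ, w τ p) *
          ∏ B ∈ π, ((∏ b ∈ B, ∏ c ∈ B, s τ b c : ℤ) : MR) := by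
    intro π hπ
    rw [mem_setPartitions] at hπ
    have hunion : π.biUnion (columnBoxes a) = columnBoxes a univ := by
      ext p
      simp only [mem_biUnion, mem_columnBoxes, mem_univ, true_and]
      constructor
      · rintro ⟨B, -, -, h⟩
        exact h
      · intro h
        obtain ⟨B, hB, hp⟩ := hπ.2.2.2 p.1 (mem_univ _)
        exact ⟨B, hB, hp, h⟩
    have hdisj : ∀ B ∈ π, ∀ C ∈ π, B ≠ C → Disjoint (columnBoxes a B) (columnBoxes a C) := by
      intro B hB C hC hne
      rw [disjoint_left]
      intro p hp hp'
      exact disjoint_left.1 (hπ.2.2.1 B hB C hC hne) (mem_columnBoxes.1 hp).1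
        (mem_columnBoxes.1 hp').1
    simp only [hmac]
    rw [prod_sum_fillingsOn π (columnBoxes a) hdisj, hunion]
    · refine Finset.sum_congr rfl fun τ _ => ?_
      rw [Finset.prod_mul_distrib, mul_comm, ← hunion, Finset.prod_biUnion hdisj]
    · intro B _ σ τ h
      congr 1
      · congr 1
        refine Finset.prod_congr rfl fun b hb => Finset.prod_congr rfl fun c hc => ?_
        simp only [hs, columnInv_congr a ρ h hb hc]
      · refine Finset.prod_congr rfl fun p hp => ?_
        simp only [hw, columnMaj_congr a h hp, h p hp]
  have hmain : (-2 : MR) ^ r * MvPolynomial.aeval substQneg1 P =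
      ∑ τ ∈ fillingsOn (columnBoxes a univ) N, (∏ p ∈ columnBoxes a univ, w τ p) *
        ((jointCumulant (fun B => ∏ b ∈ B, ∏ c ∈ B, s τ b c) univ : ℤ) : MR) := by
    have h := congrArg (MvPolynomial.aeval substQneg1) hP
    rw [map_mul, map_pow, map_sub, hq, map_one] at h
    rw [show (-1 - 1 : MR) = -2 by norm_num] at h
    rw [h]
    change MvPolynomial.aeval substQneg1 (macCumulant (columnFamily a) N) = _
    simp only [macCumulant, jointCumulant, map_sum, map_mul, map_pow, map_neg, map_one,
      map_natCast, map_prod]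
    rw [Finset.sum_congr rfl fun π hπ => by rw [hprod π hπ]]
    simp only [Finset.mul_sum, Int.cast_sum]
    rw [Finset.sum_comm]
    refine Finset.sum_congr rfl fun τ _ => Finset.sum_congr rfl fun π _ => ?_
    push_cast
    ring
  have hcum : ∀ τ, ∃ k : ℕ,
      jointCumulant (fun B => ∏ b ∈ B, ∏ c ∈ B, s τ b c) univ = (-2) ^ r * (k : ℤ) := by
    intro τ
    have := jointCumulant_sign (s τ) (fun i j => neg_one_pow_eq_or ℤ _)
      (fun i => by simp [hs, columnInv]) r 0 (univ.erase 0) (by simp) (by simp)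
    convert this using 4
    ext x
    by_cases hx : x = 0 <;> simp [hx]
  choose k hk using hcum
  have hfinal : MvPolynomial.aeval substQneg1 P = ∑ τ ∈ fillingsOn (columnBoxes a univ) N,
      (∏ p ∈ columnBoxes a univ, w τ p) * (k τ : MR) := by
    have h2 : (-2 : MR) ^ r ≠ 0 := pow_ne_zero _ (by norm_num)
    refine mul_left_cancel₀ h2 ?_
    rw [hmain, Finset.mul_sum]
    refine Finset.sum_congr rfl fun τ _ => ?_
    rw [hk]
    push_cast
    ring
  refine coeff_nonneg_of_mem_rangeS ?_
  rw [hfinal]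
  refine sum_mem fun τ _ => mul_mem (prod_mem fun p _ => mul_mem (pow_mem ?_ _) ?_)
    (natCast_mem _ _)
  · exact ⟨MvPolynomial.X _, MvPolynomial.map_X _ _⟩
  · exact ⟨MvPolynomial.X _, MvPolynomial.map_X _ _⟩

end
end
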